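/- arXiv:2506.11254 — 10 statements merged into one kernel-verified Lean document; each statement's English description precedes it below -/
import Mathlib

section
/- Let 0 ≤ K ≤ N. A function p : {0,1}^N → ℝ is an extreme point of the classical set C_{N,K} if and only if p takes values in {0,1} and, viewed as a Boolean function, p is a K-junta. In particular, the vertices of the polytope C_{N,K} are in one-to-one correspondence with the K-juntas on N Boolean variables. -/
/-- `f` is a `K`-junta: there is a set `S` of at most `K` coordinates such that
`f x = f y` whenever `x` and `y` agree on all coordinates in `S`. -/
def IsJunta {α : Type*} (N K : ℕ) (f : (Fin N → Bool) → α) : Prop :=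
  ∃ S : Finset (Fin N), S.card ≤ K ∧
    ∀ x y : Fin N → Bool, (∀ i ∈ S, x i = y i) → f x = f y

/-- The classical set `C_{N,K}`: convex combinations, over `K`-element subsets `S` of the
coordinates, of `[0,1]`-valued functions depending only on the coordinates in `S`. -/
def ClassicalSet (N K : ℕ) : Set ((Fin N → Bool) → ℝ) :=
  { p | ∃ (q : Finset (Fin N) → ℝ) (g : Finset (Fin N) → (Fin N → Bool) → ℝ),
      (∀ S, 0 ≤ q S) ∧
      (∑ S ∈ Finset.powersetCard K (Finset.univ : Finset (Fin N)), q S) = 1 ∧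
      (∀ S ∈ Finset.powersetCard K (Finset.univ : Finset (Fin N)),
        (∀ x, g S x ∈ Set.Icc (0 : ℝ) 1) ∧
        (∀ x y : Fin N → Bool, (∀ i ∈ S, x i = y i) → g S x = g S y)) ∧
      p = fun x => ∑ S ∈ Finset.powersetCard K (Finset.univ : Finset (Fin N)), q S * g S x }

/-- A `[0,1]`-valued function depending only on a `K`-element set of coordinates is classical. -/
theorem mem_classicalSet_of_dependsOn {N K : ℕ} {T : Finset (Fin N)} (hT : T.card = K)
    {p : (Fin N → Bool) → ℝ} (h01 : ∀ x, p x ∈ Set.Icc (0 : ℝ) 1)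
    (hp : ∀ x y : Fin N → Bool, (∀ i ∈ T, x i = y i) → p x = p y) :
    p ∈ ClassicalSet N K := by
  classical
  have hmem : T ∈ Finset.powersetCard K (Finset.univ : Finset (Fin N)) := by
    simp [Finset.mem_powersetCard, hT]
  refine ⟨fun S => if S = T then 1 else 0, fun S => if S = T then p else 0, ?_, ?_, ?_, ?_⟩
  · intro S
    dsimp only
    split_ifs <;> norm_num
  · rw [Finset.sum_ite_eq' _ T, if_pos hmem]
  · intro S _
    by_cases hS : S = T
    · subst hS
      simpa using ⟨h01, hp⟩
    · simp [hS]
  · funext x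
    rw [Finset.sum_eq_single_of_mem T hmem]
    · simp
    · intro S _ hS
      simp [hS]

theorem classicalSet_apply_mem_Icc {N K : ℕ} {p : (Fin N → Bool) → ℝ}
    (hp : p ∈ ClassicalSet N K) (x : Fin N → Bool) : p x ∈ Set.Icc (0 : ℝ) 1 := by
  obtain ⟨q, g, hq, hsum, hg, rfl⟩ := hp
  refine ⟨Finset.sum_nonneg fun S hS => mul_nonneg (hq S) ((hg S hS).1 x).1, ?_⟩
  rw [← hsum]
  exact Finset.sum_le_sum fun S hS => mul_le_of_le_one_right (hq S) ((hg S hS).1 x).2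

/-- An extreme point of the classical set depends only on some `K`-element set of coordinates. -/
theorem exists_dependsOn_of_mem_extremePoints {N K : ℕ} {p : (Fin N → Bool) → ℝ}
    (hp : p ∈ Set.extremePoints ℝ (ClassicalSet N K)) :
    ∃ T : Finset (Fin N), T.card = K ∧
      ∀ x y : Fin N → Bool, (∀ i ∈ T, x i = y i) → p x = p y := by
  classical
  rw [mem_extremePoints] at hp
  obtain ⟨⟨q, g, hq, hsum, hg, hpe⟩, hext⟩ := hp
  set P := Finset.powersetCard K (Finset.univ : Finset (Fin N))
  obtain ⟨T, hT, hT0⟩ : ∃ T ∈ P, 0 < q T := by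
    apply (Finset.sum_pos_iff_of_nonneg fun S _ => hq S).1
    rw [hsum]
    exact one_pos
  have hcard : T.card = K := (Finset.mem_powersetCard.1 hT).2
  have hgT : g T ∈ ClassicalSet N K := mem_classicalSet_of_dependsOn hcard (hg T hT).1 (hg T hT).2
  have hsplit : q T + ∑ S ∈ P.erase T, q S = 1 := by
    rw [Finset.add_sum_erase P q hT, hsum]
  have hpsplit : ∀ x, p x = q T * g T x + ∑ S ∈ P.erase T, q S * g S x := by
    intro x
    rw [hpe, Finset.add_sum_erase P (fun S => q S * g S x) hT]
  refine ⟨T, hcard, ?_⟩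
  suffices h : g T = p by
    rw [← h]
    exact (hg T hT).2
  set c := ∑ S ∈ P.erase T, q S with hc
  rcases (Finset.sum_nonneg fun S _ => hq S : 0 ≤ c).eq_or_lt with hc0 | hc0
  · have hz := (Finset.sum_eq_zero_iff_of_nonneg fun S _ => hq S).1 (hc.symm.trans hc0.symm)
    funext x
    rw [hpsplit, Finset.sum_eq_zero fun S hS => by rw [hz S hS, zero_mul]]
    have : q T = 1 := by linarith
    simp [this]
  · have hr : (fun x => (∑ S ∈ P.erase T, q S * g S x) / c) ∈ ClassicalSet N K := by
      refine ⟨fun S => if S = T then 0 else q S / c, g, ?_, ?_, hg, ?_⟩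
      · intro S
        dsimp only
        split_ifs
        · exact le_rfl
        · exact div_nonneg (hq S) hc0.le
      · rw [← Finset.add_sum_erase _ _ hT, if_pos rfl, zero_add,
          Finset.sum_congr rfl fun S hS => if_neg (Finset.ne_of_mem_erase hS),
          ← Finset.sum_div, ← hc, div_self hc0.ne']
      · funext x
        rw [← Finset.add_sum_erase _ _ hT]
        dsimp only
        rw [if_pos rfl, zero_mul, zero_add, Finset.sum_div]
        refine Finset.sum_congr rfl fun S hS => ?_
        rw [if_neg (Finset.ne_of_mem_erase hS)]
        ring
    refine (hext _ hgT _ hr ⟨q T, c, hT0, hc0, hsplit, ?_⟩).1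
    funext x
    simp only [Pi.add_apply, Pi.smul_apply, smul_eq_mul]
    rw [hpsplit, mul_div_cancel₀ _ hc0.ne']

/-- for `0 ≤ K ≤ N`, a function `p : {0,1}^N → ℝ` is an extreme point of the
classical set `C_{N,K}` iff `p` is `{0,1}`-valued and, viewed as a Boolean function, is a
`K`-junta. In particular the vertices of `C_{N,K}` correspond to the `K`-juntas. -/
theorem stmt0 (N K : ℕ) (hK : K ≤ N) (p : (Fin N → Bool) → ℝ) :
    p ∈ Set.extremePoints ℝ (ClassicalSet N K) ↔
      ((∀ x, p x = 0 ∨ p x = 1) ∧ IsJunta N K p) := by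
  constructor
  · intro hp
    obtain ⟨T, hT, hdep⟩ := exists_dependsOn_of_mem_extremePoints hp
    rw [mem_extremePoints] at hp
    refine ⟨fun x => ?_, T, hT.le, hdep⟩
    have h01 := classicalSet_apply_mem_Icc hp.1
    have hsq : (fun x => p x ^ 2) ∈ ClassicalSet N K :=
      mem_classicalSet_of_dependsOn hT
        (fun x => ⟨sq_nonneg _, by nlinarith [(h01 x).1, (h01 x).2]⟩)
        fun x y hxy => by rw [hdep x y hxy]
    have hsq' : (fun x => 2 * p x - p x ^ 2) ∈ ClassicalSet N K :=
      mem_classicalSet_of_dependsOn hT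
        (fun x => ⟨by nlinarith [(h01 x).1, (h01 x).2], by nlinarith [sq_nonneg (1 - p x)]⟩)
        fun x y hxy => by rw [hdep x y hxy]
    have heq := (hp.2 _ hsq _ hsq' ⟨1 / 2, 1 / 2, by norm_num, by norm_num, by norm_num, by
      funext x
      simp only [Pi.add_apply, Pi.smul_apply, smul_eq_mul]
      ring⟩).1
    have hx : p x ^ 2 = p x := congrFun heq x
    have : p x * (p x - 1) = 0 := by linarith
    exact (mul_eq_zero.1 this).imp_right sub_eq_zero.1
  · rintro ⟨h01, S, hS, hdep⟩
    obtain ⟨T, hST, hT⟩ := Finset.exists_superset_card_eq hS (by simpa using hK)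
    have hp : p ∈ ClassicalSet N K := by
      refine mem_classicalSet_of_dependsOn hT (fun x => ?_)
        fun x y hxy => hdep x y fun i hi => hxy i (hST hi)
      rcases h01 x with h | h <;> simp [h]
    rw [mem_extremePoints_iff_left]
    refine ⟨hp, ?_⟩
    rintro u hu v hv ⟨a, b, ha, hb, hab, rfl⟩
    funext x
    have hux := classicalSet_apply_mem_Icc hu x
    have hvx := classicalSet_apply_mem_Icc hv x
    have hx := h01 x
    simp only [Pi.add_apply, Pi.smul_apply, smul_eq_mul] at hx ⊢
    rcases hx with h | h
    · rw [h]
      have := mul_nonneg hb.le hvx.1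
      exact le_antisymm (by by_contra! h0; nlinarith [mul_pos ha h0]) hux.1
    · rw [h]
      have := mul_nonneg hb.le (sub_nonneg.2 hvx.2)
      exact le_antisymm hux.2 (by by_contra! h0; nlinarith [mul_pos ha (sub_pos.2 h0)])
end

section
/- For 0 ≤ K ≤ N, the number of K-juntas f : {0,1}^N → {0,1} equals ∑_{k=0}^{K} C(N,k) · ∑_{r=0}^{k} (−1)^{k−r} C(k,r) 2^{2^r}. -/
open scoped Classical in
/-- The coordinates on which `f` genuinely depends. -/
noncomputable def relevantCoords {ι β : Type*} [Fintype ι] (f : (ι → Bool) → β) : Finset ι :=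
  {i | ¬ DependsOn f {i}ᶜ}

theorem DependsOn.inter {ι β : Type*} {α : ι → Type*} {f : (Π i, α i) → β} {s t : Set ι}
    (hs : DependsOn f s) (ht : DependsOn f t) : DependsOn f (s ∩ t) := by
  classical
  intro x y h
  refine (hs (y := s.piecewise x y) fun i hi => ?_).trans (ht fun i hi => ?_)
  · simp [hi]
  · by_cases his : i ∈ s
    · simpa [his] using h i ⟨his, hi⟩
    · simp [his]

theorem DependsOn.compl_of_forall {ι β : Type*} {α : ι → Type*} {f : (Π i, α i) → β}
    (t : Finset ι) (h : ∀ i ∈ t, DependsOn f {i}ᶜ) : DependsOn f (t : Set ι)ᶜ := by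
  classical
  induction t using Finset.induction_on with
  | empty => simpa using dependsOn_univ f
  | insert a t _ ih =>
    rw [Finset.coe_insert, Set.insert_eq, Set.compl_union]
    exact (h a (by simp)).inter (ih fun i hi => h i (by simp [hi]))

theorem dependsOn_iff_relevantCoords_subset {ι β : Type*} [Fintype ι] {f : (ι → Bool) → β}
    {s : Finset ι} : DependsOn f (s : Set ι) ↔ relevantCoords f ⊆ s := by
  classical
  constructor
  · intro h i hi
    by_contra his
    have hi' : ¬ DependsOn f {i}ᶜ := by simpa [relevantCoords] using hi
    exact hi' (h.mono fun j hj => by rintro rfl; exact his hj)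
  · intro h
    have := DependsOn.compl_of_forall (f := f) sᶜ fun i hi => by
      by_contra hf
      exact Finset.mem_compl.1 hi (h (by simpa [relevantCoords] using hf))
    simpa using this

theorem isJunta_iff_card_relevantCoords_le {N K : ℕ} {β : Type*} {f : (Fin N → Bool) → β} :
    IsJunta N K f ↔ (relevantCoords f).card ≤ K := by
  constructor
  · rintro ⟨S, hS, h⟩
    exact (Finset.card_le_card
      (dependsOn_iff_relevantCoords_subset.1 fun x y hxy => h x y hxy)).trans hS
  · intro h
    exact ⟨_, h, fun x y hxy => dependsOn_iff_relevantCoords_subset.2 subset_rfl hxy⟩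

theorem card_filter_relevantCoords_subset {ι : Type*} [Fintype ι] [DecidableEq ι] (s : Finset ι) :
    Finset.card {f : (ι → Bool) → Bool | relevantCoords f ⊆ s} = 2 ^ 2 ^ s.card := by
  have hsurj : Function.Surjective (Set.domRestrict (π := fun _ : ι => Bool) (s : Set ι)) := by
    intro g
    refine ⟨fun i => if h : i ∈ s then g ⟨i, h⟩ else false, ?_⟩
    ext ⟨i, hi⟩
    simp [Finset.mem_coe.1 hi]
  have hinj := hsurj.injective_comp_right (γ := Bool)
  have hcard : Fintype.card (((s : Set ι).Elem → Bool) → Bool) = 2 ^ 2 ^ s.card := by simp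
  rw [← hcard, ← Finset.card_univ, ← Finset.card_image_of_injective _ hinj]
  congr 1
  ext f
  rw [Finset.mem_filter_univ, ← dependsOn_iff_relevantCoords_subset, dependsOn_iff_exists_comp]
  simp [eq_comm]

theorem card_filter_relevantCoords_eq {ι : Type*} [Fintype ι] [DecidableEq ι] (s : Finset ι) :
    (Finset.card {f : (ι → Bool) → Bool | relevantCoords f = s} : ℤ) =
      (fwdDiff 1)^[s.card] (fun n : ℕ => (2 : ℤ) ^ 2 ^ n) 0 := by
  induction s using Finset.strongInduction with
  | H s ih =>
    have hcount : (2 : ℤ) ^ 2 ^ s.card = ∑ t ∈ s.powerset,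
        (Finset.card {f : (ι → Bool) → Bool | relevantCoords f = t} : ℤ) := by
      have h := Finset.card_eq_sum_card_fiberwise
        (s := {f : (ι → Bool) → Bool | relevantCoords f ⊆ s}) (t := s.powerset)
        (f := relevantCoords) fun f hf => by simpa using hf
      rw [card_filter_relevantCoords_subset] at h
      have h' := congrArg (Nat.cast (R := ℤ)) h
      push_cast at h'
      rw [h']
      refine Finset.sum_congr rfl fun t ht => ?_
      rw [Finset.filter_filter]
      congr 2
      ext f
      simp only [Finset.mem_filter_univ, and_iff_right_iff_imp]
      rintro rfl
      exact Finset.mem_powerset.1 ht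
    have hshift := shift_eq_sum_fwdDiff_iter 1 (fun n : ℕ => (2 : ℤ) ^ 2 ^ n) s.card 0
    rw [← Finset.sum_powerset_apply_card
      (fun k => (fwdDiff 1)^[k] (fun n : ℕ => (2 : ℤ) ^ 2 ^ n) 0)] at hshift
    simp only [zero_add, smul_eq_mul, mul_one] at hshift
    rw [hcount, ← Finset.add_sum_erase _ _ (Finset.mem_powerset_self s),
      ← Finset.add_sum_erase _ _ (Finset.mem_powerset_self s)] at hshift
    rw [Finset.sum_congr rfl fun t ht => ih t ?_] at hshift
    · exact add_right_cancel hshift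
    · rw [Finset.mem_erase, Finset.mem_powerset] at ht
      exact ht.2.ssubset_of_ne ht.1

theorem card_filter_card_relevantCoords_eq {ι : Type*} [Fintype ι] [DecidableEq ι] (k : ℕ) :
    (Finset.card {f : (ι → Bool) → Bool | (relevantCoords f).card = k} : ℤ) =
      (Fintype.card ι).choose k * (fwdDiff 1)^[k] (fun n : ℕ => (2 : ℤ) ^ 2 ^ n) 0 := by
  rw [Finset.card_eq_sum_card_fiberwise (t := Finset.univ.powersetCard k) (f := relevantCoords)
    fun f hf => by simpa using hf]
  push_cast
  rw [Finset.sum_congr rfl fun s hs => ?_, Finset.sum_const, Finset.card_powersetCard,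
    Finset.card_univ, nsmul_eq_mul]
  have hs' := (Finset.mem_powersetCard.1 hs).2
  rw [← hs', ← card_filter_relevantCoords_eq, Finset.filter_filter]
  congr 2
  ext f
  simp only [Finset.mem_filter_univ, and_iff_right_iff_imp]
  rintro rfl
  rfl

/-- for `0 ≤ K ≤ N`, the number of `K`-juntas `f : {0,1}^N → {0,1}` equals
`∑_{k=0}^{K} C(N,k) ∑_{r=0}^{k} (−1)^{k−r} C(k,r) 2^{2^r}`. -/
theorem stmt1 (N K : ℕ) (hK : K ≤ N) :
    (Nat.card {f : (Fin N → Bool) → Bool // IsJunta N K f} : ℤ) =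
      ∑ k ∈ Finset.range (K + 1), (N.choose k : ℤ) *
        ∑ r ∈ Finset.range (k + 1),
          (-1 : ℤ) ^ (k - r) * (k.choose r : ℤ) * 2 ^ (2 ^ r) := by
  have hjunta : Nat.card {f : (Fin N → Bool) → Bool // IsJunta N K f} =
      Finset.card {f : (Fin N → Bool) → Bool | (relevantCoords f).card ≤ K} := by
    simp only [isJunta_iff_card_relevantCoords_le]
    rw [Nat.card_eq_fintype_card, Fintype.card_subtype]
  rw [hjunta, Finset.card_eq_sum_card_fiberwise (t := Finset.range (K + 1))
    (f := fun f => (relevantCoords f).card) fun f hf => by simpa [Nat.lt_succ_iff] using hf]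
  push_cast
  refine Finset.sum_congr rfl fun k hk => ?_
  have hfiber := card_filter_card_relevantCoords_eq (ι := Fin N) k
  rw [fwdDiff_iter_eq_sum_shift, Fintype.card_fin] at hfiber
  simp only [zero_add, smul_eq_mul, mul_one] at hfiber
  rw [← hfiber, Finset.filter_filter]
  congr 2
  ext f
  simp only [Finset.mem_filter_univ, and_iff_right_iff_imp]
  rintro rfl
  exact Nat.lt_succ_iff.1 (Finset.mem_range.1 hk)
end

section
/- The fingerprinting inequality is valid for N−1 classical particles: for every N ≥ 1 and every p ∈ C_{N,N−1}, one has F_N(p) = (1/(N+1)) [ (1 − p(0,…,0)) + ∑_{k=1}^N p(e_k) ] ≤ N/(N+1). -/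
/-- The fingerprinting functional
`F_N(p) = (1/(N+1)) [(1 − p(0,…,0)) + ∑_{k=1}^N p(e_k)]`. -/
noncomputable def fingerF (N : ℕ) (p : (Fin N → Bool) → ℝ) : ℝ :=
  (1 / ((N : ℝ) + 1)) *
    ((1 - p (fun _ => false)) + ∑ k : Fin N, p (fun i => decide (i = k)))

/-- A function bounded above by `1` that ignores the coordinate `m` satisfies the unnormalised
fingerprinting inequality. -/
theorem one_sub_add_sum_le_of_ignores {N : ℕ} (m : Fin N) (g : (Fin N → Bool) → ℝ)
    (hg : ∀ x, g x ≤ 1) (hm : ∀ x y : Fin N → Bool, (∀ i, i ≠ m → x i = y i) → g x = g y) :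
    (1 - g (fun _ => false)) + ∑ k : Fin N, g (fun i => decide (i = k)) ≤ N := by
  have h0 : g (fun i => decide (i = m)) = g (fun _ => false) :=
    hm _ _ fun i hi => by simp [hi]
  have h1 : ∑ k ∈ Finset.univ.erase m, g (fun i => decide (i = k)) ≤ (N : ℝ) - 1 := by
    refine (Finset.sum_le_sum fun k _ => hg _).trans_eq ?_
    have hN : 1 ≤ N := m.pos
    simp [Finset.card_erase_of_mem, Nat.cast_sub hN]
  rw [← Finset.add_sum_erase _ _ (Finset.mem_univ m), h0]
  linarith

/-- the fingerprinting inequality is valid for `N−1` classical particles: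
for every `N ≥ 1` and every `p ∈ C_{N,N−1}`, one has `F_N(p) ≤ N/(N+1)`. -/
theorem stmt10 (N : ℕ) (hN : 1 ≤ N) (p : (Fin N → Bool) → ℝ)
    (hp : p ∈ ClassicalSet N (N - 1)) :
    fingerF N p ≤ (N : ℝ) / ((N : ℝ) + 1) := by
  obtain ⟨q, g, hq, hq1, hg, rfl⟩ := hp
  have key : ∀ S ∈ Finset.powersetCard (N - 1) (Finset.univ : Finset (Fin N)),
      (1 - g S (fun _ => false)) + ∑ k : Fin N, g S (fun i => decide (i = k)) ≤ N := by
    intro S hS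
    obtain ⟨hg01, hgS⟩ := hg S hS
    have hcard : S.card < (Finset.univ : Finset (Fin N)).card := by
      rw [(Finset.mem_powersetCard.mp hS).2, Finset.card_univ, Fintype.card_fin]
      omega
    obtain ⟨m, -, hm⟩ := Finset.exists_mem_notMem_of_card_lt_card hcard
    exact one_sub_add_sum_le_of_ignores m (g S) (fun x => (hg01 x).2) fun x y hxy =>
      hgS x y fun i hi => hxy i (ne_of_mem_of_not_mem hi hm)
  have hsum := Finset.sum_le_sum fun S hS => mul_le_mul_of_nonneg_left (key S hS) (hq S)
  rw [← Finset.sum_mul, hq1, one_mul] at hsum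
  simp only [mul_add, mul_sub, mul_one, Finset.mul_sum, Finset.sum_add_distrib,
    Finset.sum_sub_distrib, hq1] at hsum
  rw [Finset.sum_comm (s := Finset.powersetCard (N - 1) Finset.univ)] at hsum
  rw [fingerF, one_div, div_eq_inv_mul]
  exact mul_le_mul_of_nonneg_left hsum (by positivity)
end

section
/- Characteristic polynomial of the block-circulant matrix M(θ,φ,ψ): for every integer N ≥ 1 and all θ, φ, ψ ∈ ℝ, the characteristic polynomial of the 2N×2N Hermitian matrix M(θ,φ,ψ) equals X^{N−1} · (X − (2 − 2 cos θ cos φ))^{N−1} · (X² − (N−1)(2 cos θ cos φ + N − 2) X − N sin² θ). In particular, its eigenvalues are 0 and 2 − 2 cos θ cos φ, each with multiplicity N−1, together with the two roots λ_± = (N−1)(2 cos θ cos φ + N − 2)/2 ± (1/2)√((N−1)²(2 cos θ cos φ + N − 2)² + 4N sin² θ). -/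
open Polynomial

/-- The diagonal 2×2 block `A` of the matrix `M(θ,φ,ψ)`. -/
noncomputable def matA (N : ℕ) (θ φ ψ : ℝ) : Matrix (Fin 2) (Fin 2) ℂ :=
  !![(Real.cos θ ^ 2 + (N : ℝ) - 2 : ℝ),
      (Real.sin θ * Real.cos θ : ℝ) * Complex.exp (Complex.I * ((φ - ψ : ℝ) : ℂ));
    (Real.sin θ * Real.cos θ : ℝ) * Complex.exp (-Complex.I * ((φ - ψ : ℝ) : ℂ)),
      (Real.sin θ ^ 2 : ℝ)]

/-- The off-diagonal 2×2 block `B` of the matrix `M(θ,φ,ψ)`. -/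
noncomputable def matB (N : ℕ) (θ φ ψ : ℝ) : Matrix (Fin 2) (Fin 2) ℂ :=
  !![(2 * Real.cos θ * Real.cos φ + (N : ℝ) - 3 : ℝ),
      (Real.sin θ : ℝ) * Complex.exp (-Complex.I * (ψ : ℂ));
    (Real.sin θ : ℝ) * Complex.exp (Complex.I * (ψ : ℂ)), 0]

/-- The `2N × 2N` block-circulant matrix `M(θ,φ,ψ)`: all diagonal 2×2 blocks equal `A`,
all off-diagonal 2×2 blocks equal `B`. -/
noncomputable def matM (N : ℕ) (θ φ ψ : ℝ) :
    Matrix (Fin N × Fin 2) (Fin N × Fin 2) ℂ :=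
  fun ik jl => if ik.1 = jl.1 then matA N θ φ ψ ik.2 jl.2 else matB N θ φ ψ ik.2 jl.2

/-- `λ₊ = (N−1)(2cosθcosφ+N−2)/2 + (1/2)√((N−1)²(2cosθcosφ+N−2)² + 4N sin²θ)`. -/
noncomputable def lamPlus (N : ℕ) (θ φ : ℝ) : ℝ :=
  ((N : ℝ) - 1) * (2 * Real.cos θ * Real.cos φ + (N : ℝ) - 2) / 2 +
    (1 / 2) * Real.sqrt (((N : ℝ) - 1) ^ 2 *
        (2 * Real.cos θ * Real.cos φ + (N : ℝ) - 2) ^ 2 +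
      4 * (N : ℝ) * Real.sin θ ^ 2)

/-- `λ₋ = (N−1)(2cosθcosφ+N−2)/2 − (1/2)√((N−1)²(2cosθcosφ+N−2)² + 4N sin²θ)`. -/
noncomputable def lamMinus (N : ℕ) (θ φ : ℝ) : ℝ :=
  ((N : ℝ) - 1) * (2 * Real.cos θ * Real.cos φ + (N : ℝ) - 2) / 2 -
    (1 / 2) * Real.sqrt (((N : ℝ) - 1) ^ 2 *
        (2 * Real.cos θ * Real.cos φ + (N : ℝ) - 2) ^ 2 +
      4 * (N : ℝ) * Real.sin θ ^ 2)

open Matrix in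
/-- The determinant of a square block matrix with `n + 1` diagonal blocks equal to `P` and all
off-diagonal blocks equal to `Q`. -/
theorem Matrix.det_of_const_blocks {R m : Type*} [CommRing R] [Fintype m] [DecidableEq m] (n : ℕ)
    (P Q : Matrix m m R) :
    (Matrix.of fun i j : Fin (n + 1) × m => if i.1 = j.1 then P i.2 j.2 else Q i.2 j.2).det =
      (P - Q).det ^ n * (P + (n : R) • Q).det := by
  let e : m ⊕ (m × Fin n) ≃ Fin (n + 1) × m :=
    { toFun := Sum.elim (fun k => (0, k)) fun p => (p.2.succ, p.1)
      invFun := fun q => Fin.cases (Sum.inl q.2) (fun i => Sum.inr (q.2, i)) q.1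
      left_inv := by rintro (k | ⟨k, i⟩) <;> rfl
      right_inv := by
        rintro ⟨i, k⟩
        induction i using Fin.cases <;> rfl }
  let D : Matrix (m × Fin n) (m × Fin n) R := blockDiagonal fun _ => P - Q
  let U : Matrix (m × Fin n) m R := of fun p k => (1 : Matrix m m R) p.1 k
  let V : Matrix m (m × Fin n) R := of fun k p => Q k p.1
  have hblocks : (Matrix.of fun i j : Fin (n + 1) × m =>
      if i.1 = j.1 then P i.2 j.2 else Q i.2 j.2).submatrix e e =
      fromBlocks P V (U * Q) (U * V + D) := by
    ext (k | ⟨k, i⟩) (l | ⟨l, j⟩)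
    · simp [e]
    · simp [e, V, (Fin.succ_ne_zero _).symm]
    · simp [e, U, mul_apply, one_apply]
    · by_cases h : i = j <;> simp [e, U, V, D, mul_apply, one_apply, blockDiagonal_apply, h]
  have hDU : D * U = U * (P - Q) := by
    ext ⟨k, i⟩ l
    simp [D, U, mul_apply, one_apply, blockDiagonal_apply, Fintype.sum_prod_type]
  have hVU : V * U = (n : R) • Q := by
    ext k l
    simp [V, U, mul_apply, one_apply, Fintype.sum_prod_type]
  have hmul : fromBlocks 1 0 (-U) 1 * fromBlocks P V (U * Q) (U * V + D) * fromBlocks 1 0 U 1 =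
      fromBlocks (P + (n : R) • Q) V 0 D := by
    simp [fromBlocks_multiply, hVU, hDU, Matrix.mul_sub]
  have hdet := congrArg det hmul
  rw [det_mul, det_mul, det_fromBlocks_zero₁₂, det_fromBlocks_zero₁₂,
    det_fromBlocks_zero₂₁] at hdet
  rw [← det_submatrix_equiv_self e, hblocks]
  simpa [D, det_blockDiagonal, mul_comm] using hdet

open Matrix in
/-- The characteristic polynomial of a square block matrix with `n + 1` diagonal blocks equal to
`A` and all off-diagonal blocks equal to `B`. -/
theorem Matrix.charpoly_of_const_blocks {R m : Type*} [CommRing R] [Fintype m] [DecidableEq m]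
    (n : ℕ) (A B : Matrix m m R) :
    (Matrix.of fun i j : Fin (n + 1) × m =>
        if i.1 = j.1 then A i.2 j.2 else B i.2 j.2).charpoly =
      (A - B).charpoly ^ n * (A + (n : R) • B).charpoly := by
  have hsub : charmatrix (A - B) = charmatrix A - -B.map C := by
    ext k l
    simp [charmatrix_apply]
    ring
  have hadd : charmatrix (A + (n : R) • B) = charmatrix A + (n : R[X]) • -B.map C := by
    ext k l
    simp [charmatrix_apply]
    ring
  rw [charpoly, charpoly, charpoly, hsub, hadd, ← det_of_const_blocks]
  congr 1
  ext ⟨i, k⟩ ⟨j, l⟩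
  by_cases h : i = j <;> by_cases h' : k = l <;> simp [charmatrix_apply, diagonal_apply, h, h']

/-- Products of the phases occurring in the off-diagonal entries of `matA` and `matB`. -/
theorem exp_phase_products (φ ψ : ℝ) :
    Complex.exp (Complex.I * ((φ - ψ : ℝ) : ℂ)) * Complex.exp (-Complex.I * ((φ - ψ : ℝ) : ℂ)) = 1 ∧
      Complex.exp (-Complex.I * (ψ : ℂ)) * Complex.exp (Complex.I * (ψ : ℂ)) = 1 ∧
      Complex.exp (Complex.I * ((φ - ψ : ℝ) : ℂ)) * Complex.exp (Complex.I * (ψ : ℂ)) +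
        Complex.exp (-Complex.I * (ψ : ℂ)) * Complex.exp (-Complex.I * ((φ - ψ : ℝ) : ℂ)) =
          2 * (Real.cos φ : ℂ) := by
  simp only [← Complex.exp_add]
  refine ⟨?_, ?_, ?_⟩
  · simp
  · simp
  · rw [Complex.ofReal_cos, Complex.two_cos]
    push_cast
    ring_nf

theorem charpoly_matA_sub_matB (N : ℕ) (θ φ ψ : ℝ) :
    (matA N θ φ ψ - matB N θ φ ψ).charpoly =
      X * (X - C ((2 - 2 * Real.cos θ * Real.cos φ : ℝ) : ℂ)) := by
  have htr : (matA N θ φ ψ - matB N θ φ ψ).trace =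
      ((2 - 2 * Real.cos θ * Real.cos φ : ℝ) : ℂ) := by
    simp only [matA, matB, Matrix.trace_fin_two, Matrix.sub_apply, Matrix.of_apply,
      Matrix.cons_val', Matrix.cons_val_zero, Matrix.cons_val_one]
    push_cast
    linear_combination Complex.sin_sq_add_cos_sq (θ : ℂ)
  have hdet : (matA N θ φ ψ - matB N θ φ ψ).det = 0 := by
    obtain ⟨h₁, h₂, h₃⟩ := exp_phase_products φ ψ
    simp only [matA, matB, Matrix.det_fin_two, Matrix.sub_apply, Matrix.of_apply,
      Matrix.cons_val', Matrix.cons_val_zero, Matrix.cons_val_one]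
    push_cast at h₁ h₂ h₃ ⊢
    linear_combination -Complex.sin (θ : ℂ) ^ 2 * Complex.cos (θ : ℂ) ^ 2 * h₁ - Complex.sin (θ : ℂ) ^ 2 * h₂ +
      Complex.sin (θ : ℂ) ^ 2 * Complex.cos (θ : ℂ) * h₃
  rw [Matrix.charpoly_fin_two, htr, hdet, C_0]
  ring

theorem charpoly_matA_add_smul_matB (n : ℕ) (θ φ ψ : ℝ) :
    (matA (n + 1) θ φ ψ + (n : ℂ) • matB (n + 1) θ φ ψ).charpoly =
      X ^ 2 - C (((n : ℝ) * (2 * Real.cos θ * Real.cos φ + n - 1) : ℝ) : ℂ) * X -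
        C ((((n : ℝ) + 1) * Real.sin θ ^ 2 : ℝ) : ℂ) := by
  have htr : (matA (n + 1) θ φ ψ + (n : ℂ) • matB (n + 1) θ φ ψ).trace =
      (((n : ℝ) * (2 * Real.cos θ * Real.cos φ + n - 1) : ℝ) : ℂ) := by
    simp only [matA, matB, Matrix.trace_fin_two, Matrix.add_apply,
      Matrix.smul_apply, Matrix.of_apply, Matrix.cons_val', Matrix.cons_val_zero,
      Matrix.cons_val_one, smul_eq_mul]
    push_cast
    linear_combination Complex.sin_sq_add_cos_sq (θ : ℂ)
  have hdet : (matA (n + 1) θ φ ψ + (n : ℂ) • matB (n + 1) θ φ ψ).det =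
      -((((n : ℝ) + 1) * Real.sin θ ^ 2 : ℝ) : ℂ) := by
    obtain ⟨h₁, h₂, h₃⟩ := exp_phase_products φ ψ
    simp only [matA, matB, Matrix.det_fin_two, Matrix.add_apply,
      Matrix.smul_apply, Matrix.of_apply, Matrix.cons_val', Matrix.cons_val_zero,
      Matrix.cons_val_one, smul_eq_mul]
    push_cast at h₁ h₂ h₃ ⊢
    linear_combination -Complex.sin (θ : ℂ) ^ 2 * Complex.cos (θ : ℂ) ^ 2 * h₁ -
      (n : ℂ) ^ 2 * Complex.sin (θ : ℂ) ^ 2 * h₂ -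
      (n : ℂ) * Complex.sin (θ : ℂ) ^ 2 * Complex.cos (θ : ℂ) * h₃
  rw [Matrix.charpoly_fin_two, htr, hdet, C_neg]
  ring

theorem lamPlus_add_lamMinus (N : ℕ) (θ φ : ℝ) :
    lamPlus N θ φ + lamMinus N θ φ =
      ((N : ℝ) - 1) * (2 * Real.cos θ * Real.cos φ + (N : ℝ) - 2) := by
  unfold lamPlus lamMinus
  ring

theorem lamPlus_mul_lamMinus (N : ℕ) (θ φ : ℝ) :
    lamPlus N θ φ * lamMinus N θ φ = -((N : ℝ) * Real.sin θ ^ 2) := by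
  have h := Real.sq_sqrt (show 0 ≤ ((N : ℝ) - 1) ^ 2 *
      (2 * Real.cos θ * Real.cos φ + (N : ℝ) - 2) ^ 2 + 4 * (N : ℝ) * Real.sin θ ^ 2 by positivity)
  unfold lamPlus lamMinus
  linear_combination (-1 / 4) * h

/-- the characteristic polynomial of `M(θ,φ,ψ)` equals
`X^{N−1} (X − (2 − 2cosθcosφ))^{N−1} (X² − (N−1)(2cosθcosφ+N−2) X − N sin²θ)`;
in particular the quadratic factor has roots `λ₊` and `λ₋`. -/
theorem stmt12 (N : ℕ) (hN : 1 ≤ N) (θ φ ψ : ℝ) :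
    (matM N θ φ ψ).charpoly =
        X ^ (N - 1) *
          (X - C ((2 - 2 * Real.cos θ * Real.cos φ : ℝ) : ℂ)) ^ (N - 1) *
          (X ^ 2 -
            C ((((N : ℝ) - 1) *
                (2 * Real.cos θ * Real.cos φ + (N : ℝ) - 2) : ℝ) : ℂ) * X -
            C (((N : ℝ) * Real.sin θ ^ 2 : ℝ) : ℂ)) ∧
      (X ^ 2 -
          C ((((N : ℝ) - 1) *
              (2 * Real.cos θ * Real.cos φ + (N : ℝ) - 2) : ℝ) : ℂ) * X -
          C (((N : ℝ) * Real.sin θ ^ 2 : ℝ) : ℂ)) =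
        (X - C ((lamPlus N θ φ : ℝ) : ℂ)) * (X - C ((lamMinus N θ φ : ℝ) : ℂ)) := by
  obtain ⟨n, rfl⟩ : ∃ n, N = n + 1 := ⟨N - 1, by omega⟩
  constructor
  · have hM : matM (n + 1) θ φ ψ = Matrix.of fun i j : Fin (n + 1) × Fin 2 =>
        if i.1 = j.1 then matA (n + 1) θ φ ψ i.2 j.2 else matB (n + 1) θ φ ψ i.2 j.2 := rfl
    rw [hM, Matrix.charpoly_of_const_blocks, charpoly_matA_sub_matB, charpoly_matA_add_smul_matB,
      mul_pow, Nat.add_sub_cancel]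
    congr 5 <;> push_cast <;> ring_nf
  · rw [← lamPlus_add_lamMinus, ← neg_neg (((n + 1 : ℕ) : ℝ) * Real.sin θ ^ 2),
      ← lamPlus_mul_lamMinus]
    simp only [Complex.ofReal_add, Complex.ofReal_mul, Complex.ofReal_neg, C_add, C_mul, C_neg]
    ring
end

section
/- Trace-norm formula: for every integer N ≥ 1 and all θ, φ, ψ ∈ ℝ, the sum of the absolute values of the eigenvalues of the Hermitian matrix M(θ,φ,ψ) equals (N−1)(2 − 2 cos θ cos φ) + √(4N sin² θ + (N−1)²(2 cos θ cos φ + N − 2)²). -/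
namespace Matrix

open Polynomial
open scoped Kronecker

/-- The block matrix with all diagonal blocks equal to `A` and all off-diagonal blocks equal
to `B`. -/
def constBlock {ι n R : Type*} [DecidableEq ι] (A B : Matrix n n R) :
    Matrix (ι × n) (ι × n) R :=
  of fun i j => if i.1 = j.1 then A i.2 j.2 else B i.2 j.2

variable {ι n : Type*} [Fintype ι] [DecidableEq ι] [Fintype n] [DecidableEq n]

theorem det_constBlock_mul_det_of_isUnit {R : Type*} [CommRing R] (A B : Matrix n n R)
    (h : IsUnit (A - B).det) :
    (constBlock (ι := ι) A B).det * (A - B).det =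
      (A - B).det ^ Fintype.card ι * (A + ((Fintype.card ι : R) - 1) • B).det := by
  let U : Matrix (ι × n) n R := of fun i k => B i.2 k
  let V : Matrix n (ι × n) R := of fun k j => if k = j.2 then 1 else 0
  have hM : constBlock (ι := ι) A B = (1 : Matrix ι ι R) ⊗ₖ (A - B) + U * V := by
    ext ⟨i, k⟩ ⟨j, l⟩
    by_cases hij : i = j <;> simp [constBlock, U, V, mul_apply, hij]
  have hdet : ((1 : Matrix ι ι R) ⊗ₖ (A - B)).det = (A - B).det ^ Fintype.card ι := by
    simp [det_kronecker]
  have hV : V * ((1 : Matrix ι ι R) ⊗ₖ (A - B))⁻¹ * U =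
      (A - B)⁻¹ * ((Fintype.card ι : R) • B) := by
    rw [inv_kronecker, inv_one, Matrix.mul_assoc]
    ext k l
    simp [U, V, mul_apply, Fintype.sum_prod_type, one_apply, Finset.mul_sum, mul_left_comm]
  rw [hM, det_add_mul _ _ (by rw [hdet]; exact h.pow _), hdet, hV, mul_assoc,
    mul_comm (det (1 + _)), ← det_mul, Matrix.mul_add, Matrix.mul_one,
    mul_nonsing_inv_cancel_left _ _ h, sub_smul,
    one_smul]
  congr 2
  abel

theorem det_constBlock_mul_det {R : Type*} [CommRing R] [IsDomain R] (A B : Matrix n n R)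
    (h : (A - B).det ≠ 0) :
    (constBlock (ι := ι) A B).det * (A - B).det =
      (A - B).det ^ Fintype.card ι * (A + ((Fintype.card ι : R) - 1) • B).det := by
  let f := algebraMap R (FractionRing R)
  have hf : Function.Injective f := IsFractionRing.injective R (FractionRing R)
  have hsub : f.mapMatrix A - f.mapMatrix B = f.mapMatrix (A - B) :=
    (map_sub f.mapMatrix A B).symm
  have hblock : constBlock (ι := ι) (f.mapMatrix A) (f.mapMatrix B) =
      f.mapMatrix (constBlock A B) := by
    ext i j
    simp [constBlock, apply_ite f]
  have hadd : f.mapMatrix A + ((Fintype.card ι : FractionRing R) - 1) • f.mapMatrix B =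
      f.mapMatrix (A + ((Fintype.card ι : R) - 1) • B) := by
    ext i j
    simp
  have key := det_constBlock_mul_det_of_isUnit (ι := ι) (f.mapMatrix A) (f.mapMatrix B)
    (by
      rw [hsub, ← RingHom.map_det, isUnit_iff_ne_zero]
      exact (map_ne_zero_iff f hf).mpr h)
  rw [hsub, hblock, hadd] at key
  simp only [← RingHom.map_det, ← map_pow, ← map_mul] at key
  exact hf key

theorem charpoly_constBlock_mul_charpoly {R : Type*} [CommRing R] [IsDomain R]
    (A B : Matrix n n R) :
    (constBlock (ι := ι) A B).charpoly * (A - B).charpoly =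
      (A - B).charpoly ^ Fintype.card ι *
        (A + ((Fintype.card ι : R) - 1) • B).charpoly := by
  have hsub : (A - B).charmatrix = A.charmatrix - -(C : R →+* R[X]).mapMatrix B := by
    ext1 i j
    simp [charmatrix_apply]
    ring
  have hblock : (constBlock (ι := ι) A B).charmatrix =
      constBlock A.charmatrix (-(C : R →+* R[X]).mapMatrix B) := by
    ext1 ⟨i, k⟩ ⟨j, l⟩
    by_cases hij : i = j <;>
      simp [constBlock, charmatrix_apply, diagonal_apply, hij]
  have hadd : (A + ((Fintype.card ι : R) - 1) • B).charmatrix =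
      A.charmatrix + ((Fintype.card ι : R[X]) - 1) • -(C : R →+* R[X]).mapMatrix B := by
    ext1 i j
    simp [charmatrix_apply]
    ring
  have h0 : (A - B).charpoly ≠ 0 := (charpoly_monic _).ne_zero
  unfold charpoly at h0 ⊢
  rw [hblock, hadd]
  rw [hsub] at h0 ⊢
  exact det_constBlock_mul_det _ _ h0

theorem charpoly_fin_two_eq_mul {R : Type*} [CommRing R] [Nontrivial R]
    (A : Matrix (Fin 2) (Fin 2) R) {a b : R} (ht : A.trace = a + b) (hd : A.det = a * b) :
    A.charpoly = (X - C a) * (X - C b) := by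
  rw [charpoly_fin_two, ht, hd]
  simp only [map_add, map_mul]
  ring

theorem sum_abs_eigenvalues_eq {m : Type*} [Fintype m] [DecidableEq m] {A : Matrix m m ℂ}
    (hA : A.IsHermitian) :
    ∑ i, |hA.eigenvalues i| = (A.charpoly.roots.map norm).sum := by
  rw [hA.roots_charpoly_eq_eigenvalues]
  simp

/-- Trace norm of a Hermitian block matrix with constant diagonal `2 × 2` blocks `A` and constant
off-diagonal `2 × 2` blocks `B`, from the eigenvalues of `A - B` and `A + (|ι| - 1) B`. -/
theorem sum_abs_eigenvalues_constBlock_add {A B : Matrix (Fin 2) (Fin 2) ℂ}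
    (h : (constBlock (ι := ι) A B).IsHermitian) {a b c d : ℂ}
    (ht : (A - B).trace = a + b) (hd : (A - B).det = a * b)
    (ht' : (A + ((Fintype.card ι : ℂ) - 1) • B).trace = c + d)
    (hd' : (A + ((Fintype.card ι : ℂ) - 1) • B).det = c * d) :
    ∑ i, |h.eigenvalues i| + (‖a‖ + ‖b‖) =
      Fintype.card ι * (‖a‖ + ‖b‖) + (‖c‖ + ‖d‖) := by
  have key := charpoly_constBlock_mul_charpoly (ι := ι) A B
  have hne := (charpoly_monic (constBlock (ι := ι) A B)).ne_zero
  have hX (z : ℂ) : (X - C z) ≠ 0 := X_sub_C_ne_zero z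
  rw [charpoly_fin_two_eq_mul _ ht hd, charpoly_fin_two_eq_mul _ ht' hd'] at key
  have hroots := congrArg (fun p : ℂ[X] => (p.roots.map norm).sum) key
  have h₁ := mul_ne_zero (hX a) (hX b)
  have h₂ := mul_ne_zero (hX c) (hX d)
  simp only [roots_mul (mul_ne_zero hne h₁), roots_mul (mul_ne_zero (pow_ne_zero _ h₁) h₂),
    roots_mul h₁, roots_mul h₂, roots_pow, roots_X_sub_C] at hroots
  rw [sum_abs_eigenvalues_eq]
  simp only [Multiset.map_add, Multiset.map_nsmul, Multiset.map_singleton, Multiset.sum_add,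
    Multiset.sum_nsmul, Multiset.sum_singleton, nsmul_eq_mul] at hroots
  exact hroots

end Matrix

theorem det_matA_add_smul_matB (N : ℕ) (θ φ ψ x : ℝ) :
    (matA N θ φ ψ + (x : ℂ) • matB N θ φ ψ).det =
      ((Real.sin θ ^ 2 * (N - 2 + x * (N - 3) - x ^ 2) : ℝ) : ℂ) := by
  have h₁ : Complex.exp (Complex.I * ((φ - ψ : ℝ) : ℂ)) *
      Complex.exp (-Complex.I * ((φ - ψ : ℝ) : ℂ)) = 1 := by
    rw [← Complex.exp_add]; simp
  have h₂ : Complex.exp (-Complex.I * (ψ : ℂ)) * Complex.exp (Complex.I * (ψ : ℂ)) = 1 := by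
    rw [← Complex.exp_add]; simp
  have h₃ : Complex.exp (Complex.I * ((φ - ψ : ℝ) : ℂ)) * Complex.exp (Complex.I * (ψ : ℂ)) +
      Complex.exp (-Complex.I * (ψ : ℂ)) * Complex.exp (-Complex.I * ((φ - ψ : ℝ) : ℂ)) =
      2 * (Real.cos φ : ℂ) := by
    rw [← Complex.exp_add, ← Complex.exp_add, Complex.ofReal_cos, Complex.two_cos]
    push_cast
    ring_nf
  simp only [matA, matB, Matrix.det_fin_two, Matrix.add_apply, Matrix.smul_apply, Matrix.of_apply,
    Matrix.cons_val, smul_eq_mul]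
  push_cast [-Complex.ofReal_cos, -Complex.ofReal_sin] at h₁ h₂ h₃ ⊢
  linear_combination (-(Real.sin θ : ℂ) ^ 2 * (Real.cos θ : ℂ) ^ 2) * h₁ -
    (x : ℂ) ^ 2 * (Real.sin θ : ℂ) ^ 2 * h₂ -
    (x : ℂ) * (Real.sin θ : ℂ) ^ 2 * (Real.cos θ : ℂ) * h₃

theorem trace_matA_add_smul_matB (N : ℕ) (θ φ ψ x : ℝ) :
    (matA N θ φ ψ + (x : ℂ) • matB N θ φ ψ).trace =
      ((N - 1 + x * (2 * Real.cos θ * Real.cos φ + N - 3) : ℝ) : ℂ) := by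
  simp only [matA, matB, Matrix.trace_fin_two, Matrix.add_apply, Matrix.smul_apply,
    Matrix.of_apply, Matrix.cons_val, smul_eq_mul]
  push_cast
  linear_combination Complex.sin_sq_add_cos_sq (θ : ℂ)

theorem abs_half_add_sqrt_add_abs_half_sub_sqrt {T q : ℝ} (hq : 0 ≤ q) :
    |(T + √(q + T ^ 2)) / 2| + |(T - √(q + T ^ 2)) / 2| = √(q + T ^ 2) := by
  have h : |T| ≤ √(q + T ^ 2) := Real.abs_le_sqrt (by linarith)
  obtain ⟨h₁, h₂⟩ := abs_le.mp h
  rw [abs_of_nonneg (by linarith), abs_of_nonpos (by linarith)]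
  ring

/-- the trace norm (sum of absolute values of the eigenvalues) of the
Hermitian matrix `M(θ,φ,ψ)` equals
`(N−1)(2 − 2cosθcosφ) + √(4N sin²θ + (N−1)²(2cosθcosφ+N−2)²)`. -/
theorem stmt13 (N : ℕ) (hN : 1 ≤ N) (θ φ ψ : ℝ)
    (hM : (matM N θ φ ψ).IsHermitian) :
    (∑ i, |hM.eigenvalues i|) =
      ((N : ℝ) - 1) * (2 - 2 * Real.cos θ * Real.cos φ) +
        Real.sqrt (4 * (N : ℝ) * Real.sin θ ^ 2 +
          ((N : ℝ) - 1) ^ 2 *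
            (2 * Real.cos θ * Real.cos φ + (N : ℝ) - 2) ^ 2) := by
  have hsub : matA N θ φ ψ - matB N θ φ ψ =
      matA N θ φ ψ + ((-1 : ℝ) : ℂ) • matB N θ φ ψ := by simp [sub_eq_add_neg]
  have hadd : ((Fintype.card (Fin N) : ℂ) - 1) = (((N : ℝ) - 1 : ℝ) : ℂ) := by simp
  set t : ℝ := 2 - 2 * Real.cos θ * Real.cos φ with ht
  have ht0 : 0 ≤ t := by
    nlinarith [sq_nonneg (Real.cos θ - Real.cos φ), Real.cos_sq_le_one θ, Real.cos_sq_le_one φ]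
  set T : ℝ := (N - 1) * (2 * Real.cos θ * Real.cos φ + N - 2) with hT
  set q : ℝ := 4 * N * Real.sin θ ^ 2 with hq
  have hq0 : 0 ≤ q := by positivity
  have hs : √(q + T ^ 2) ^ 2 = q + T ^ 2 := Real.sq_sqrt (by positivity)
  have key := Matrix.sum_abs_eigenvalues_constBlock_add (ι := Fin N) hM
    (a := 0) (b := t) (c := ((T + √(q + T ^ 2)) / 2 : ℝ)) (d := ((T - √(q + T ^ 2)) / 2 : ℝ))
    (by
      rw [hsub, trace_matA_add_smul_matB, zero_add]
      congr 1
      rw [ht]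
      ring)
    (by
      rw [hsub, det_matA_add_smul_matB, zero_mul, Complex.ofReal_eq_zero]
      ring)
    (by
      rw [hadd, trace_matA_add_smul_matB, ← Complex.ofReal_add]
      congr 1
      rw [hT]
      ring)
    (by
      rw [hadd, det_matA_add_smul_matB, ← Complex.ofReal_mul]
      congr 1
      linear_combination (1 / 4) * hs + (1 / 4) * hq)
  simp only [norm_zero, zero_add, Complex.norm_real, Real.norm_eq_abs, abs_of_nonneg ht0,
    abs_half_add_sqrt_add_abs_half_sub_sqrt hq0, Fintype.card_fin] at key
  rw [← mul_pow, ← hT]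
  have key' : ∑ i, |hM.eigenvalues i| + t = N * t + √(q + T ^ 2) := key
  linear_combination key'
end

section
/- Scalar optimization underlying Theorem 1: for every integer N > 3, the function g(θ,φ) = (N−1)(2 − 2 cos θ cos φ) + √(4N sin² θ + (N−1)²(2 cos θ cos φ + N − 2)²) of real variables θ, φ has greatest value N(N−1) + 2N/(N²−3N+1), attained at φ = 0 and θ = arccos((1−N)/(N²−3N+1)). -/
/-- The scalar objective
`g(θ,φ) = (N−1)(2 − 2cosθcosφ) + √(4N sin²θ + (N−1)²(2cosθcosφ+N−2)²)`. -/
noncomputable def gFun (N : ℕ) (θ φ : ℝ) : ℝ :=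
  ((N : ℝ) - 1) * (2 - 2 * Real.cos θ * Real.cos φ) +
    Real.sqrt (4 * (N : ℝ) * Real.sin θ ^ 2 +
      ((N : ℝ) - 1) ^ 2 * (2 * Real.cos θ * Real.cos φ + (N : ℝ) - 2) ^ 2)

/-- The square completion behind the optimization of `gFun` on the slice `φ = 0`. -/
lemma sq_sub_radicand_eq {n : ℝ} (hD : n ^ 2 - 3 * n + 1 ≠ 0) (p : ℝ) :
    ((n - 1) * (2 * p + n - 2) + 2 * n / (n ^ 2 - 3 * n + 1)) ^ 2 -
        (4 * n * (1 - p ^ 2) + (n - 1) ^ 2 * (2 * p + n - 2) ^ 2) =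
      4 * n * (p - (1 - n) / (n ^ 2 - 3 * n + 1)) ^ 2 := by
  obtain ⟨d, hd⟩ : ∃ d, d = n ^ 2 - 3 * n + 1 := ⟨_, rfl⟩
  rw [← hd] at hD ⊢
  field_simp
  rw [hd]
  ring

/-- for every integer `N > 3`, the function `g(θ,φ)` has greatest value
`N(N−1) + 2N/(N²−3N+1)`, attained at `φ = 0` and `θ = arccos((1−N)/(N²−3N+1))`. -/
theorem stmt14 (N : ℕ) (hN : 3 < N) :
    IsGreatest (Set.range fun tp : ℝ × ℝ => gFun N tp.1 tp.2)
        ((N : ℝ) * ((N : ℝ) - 1) +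
          2 * (N : ℝ) / ((N : ℝ) ^ 2 - 3 * (N : ℝ) + 1)) ∧
      gFun N (Real.arccos ((1 - (N : ℝ)) / ((N : ℝ) ^ 2 - 3 * (N : ℝ) + 1))) 0 =
        (N : ℝ) * ((N : ℝ) - 1) +
          2 * (N : ℝ) / ((N : ℝ) ^ 2 - 3 * (N : ℝ) + 1) := by
  have hn : (4 : ℝ) ≤ N := by exact_mod_cast hN
  unfold gFun
  generalize (N : ℝ) = n at hn ⊢
  have hD : 0 < n ^ 2 - 3 * n + 1 := by nlinarith
  have hfrac : 0 ≤ 2 * n / (n ^ 2 - 3 * n + 1) := by positivity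
  have hroot : ∀ p : ℝ, -1 ≤ p →
      0 ≤ (n - 1) * (2 * p + n - 2) + 2 * n / (n ^ 2 - 3 * n + 1) := fun p hp =>
    add_nonneg (mul_nonneg (by linarith) (by linarith)) hfrac
  have hlower : -1 ≤ (1 - n) / (n ^ 2 - 3 * n + 1) := by
    rw [le_div_iff₀ hD]
    nlinarith
  have hupper : (1 - n) / (n ^ 2 - 3 * n + 1) ≤ 1 := by
    rw [div_le_iff₀ hD]
    nlinarith
  have hattained : (n - 1) * (2 - 2 *
      Real.cos (Real.arccos ((1 - n) / (n ^ 2 - 3 * n + 1))) * Real.cos 0) +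
      Real.sqrt (4 * n * Real.sin (Real.arccos ((1 - n) / (n ^ 2 - 3 * n + 1))) ^ 2 +
        (n - 1) ^ 2 * (2 * Real.cos (Real.arccos ((1 - n) / (n ^ 2 - 3 * n + 1))) *
          Real.cos 0 + n - 2) ^ 2) =
      n * (n - 1) + 2 * n / (n ^ 2 - 3 * n + 1) := by
    have hsq := sq_sub_radicand_eq hD.ne' ((1 - n) / (n ^ 2 - 3 * n + 1))
    rw [sub_self, zero_pow two_ne_zero, mul_zero, sub_eq_zero] at hsq
    rw [Real.sin_sq, Real.cos_arccos hlower hupper, Real.cos_zero, mul_one, ← hsq,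
      Real.sqrt_sq (hroot _ hlower)]
    ring
  refine ⟨⟨⟨(_, 0), hattained⟩, ?_⟩, hattained⟩
  rintro _ ⟨⟨θ, φ⟩, rfl⟩
  dsimp only
  rw [mul_assoc 2 (Real.cos θ), Real.sin_sq]
  have hp : (Real.cos θ * Real.cos φ) ^ 2 ≤ Real.cos θ ^ 2 := by
    rw [mul_pow]
    exact mul_le_of_le_one_right (sq_nonneg _) (Real.cos_sq_le_one φ)
  have hp_lower : -1 ≤ Real.cos θ * Real.cos φ :=
    (abs_le_one_iff_mul_self_le_one.2 (by nlinarith [Real.cos_sq_le_one θ]) |> abs_le.1).1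
  generalize Real.cos θ * Real.cos φ = p at hp hp_lower ⊢
  have hsq := sq_sub_radicand_eq hD.ne' p
  have hsqrt : Real.sqrt (4 * n * (1 - Real.cos θ ^ 2) +
      (n - 1) ^ 2 * (2 * p + n - 2) ^ 2) ≤
      (n - 1) * (2 * p + n - 2) + 2 * n / (n ^ 2 - 3 * n + 1) := by
    refine Real.sqrt_le_iff.2 ⟨hroot p hp_lower, ?_⟩
    have hdefect : 0 ≤ 4 * n * (p - (1 - n) / (n ^ 2 - 3 * n + 1)) ^ 2 := by positivity
    have hsin : 4 * n * (1 - Real.cos θ ^ 2) ≤ 4 * n * (1 - p ^ 2) := by gcongr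
    linarith
  linarith
end

section
/- Scalar optimization for small N: for N ∈ {2, 3}, the function g(θ,φ) = (N−1)(2 − 2 cos θ cos φ) + √(4N sin² θ + (N−1)²(2 cos θ cos φ + N − 2)²) of real variables θ, φ has greatest value (N−1)(8−N) (i.e., 6 for N = 2 and 10 for N = 3), attained at θ = π, φ = 0. Consequently the maximal symmetric-encoding quantum violations of the fingerprinting inequality are δ_2 = 1/3 and δ_3 = 1/6. -/
theorem gFun_pi_zero {N : ℕ} (hN : N = 2 ∨ N = 3) :
    gFun N Real.pi 0 = ((N : ℝ) - 1) * (8 - (N : ℝ)) := by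
  have h : √(4 : ℝ) = 2 := by
    rw [show (4 : ℝ) = 2 ^ 2 by norm_num, Real.sqrt_sq zero_le_two]
  rcases hN with rfl | rfl <;> norm_num [gFun, h]

theorem gFun_le {N : ℕ} (hN : N = 2 ∨ N = 3) (θ φ : ℝ) :
    gFun N θ φ ≤ ((N : ℝ) - 1) * (8 - (N : ℝ)) := by
  have hsq : (Real.cos θ * Real.cos φ) ^ 2 ≤ Real.cos θ ^ 2 := by
    rw [mul_pow]
    exact mul_le_of_le_one_right (sq_nonneg _) (Real.cos_sq_le_one φ)
  have hx : -1 ≤ Real.cos θ * Real.cos φ :=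
    (abs_le_of_sq_le_sq' (by linarith [Real.cos_sq_le_one θ]) zero_le_one).1
  simp only [gFun, mul_assoc 2 (Real.cos θ), Real.sin_sq]
  generalize Real.cos θ * Real.cos φ = x at hsq hx ⊢
  rw [← le_sub_iff_add_le']
  rcases hN with rfl | rfl
  · apply Real.sqrt_le_iff.mpr
    push_cast
    constructor <;> nlinarith [sq_nonneg (x + 1)]
  · apply Real.sqrt_le_iff.mpr
    push_cast
    constructor <;> nlinarith [sq_nonneg (x + 1)]

/-- for `N ∈ {2,3}`, the function `g(θ,φ)` has greatest value `(N−1)(8−N)`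
(i.e. `6` for `N = 2` and `10` for `N = 3`), attained at `θ = π`, `φ = 0`; consequently,
via `δ_N = 1/2 + (max g)/(2N(N+1)) − N/(N+1)`, the maximal symmetric-encoding quantum
violations of the fingerprinting inequality are `δ₂ = 1/3` and `δ₃ = 1/6`. -/
theorem stmt15 (N : ℕ) (hN : N = 2 ∨ N = 3) :
    IsGreatest (Set.range fun tp : ℝ × ℝ => gFun N tp.1 tp.2)
        (((N : ℝ) - 1) * (8 - (N : ℝ))) ∧
      gFun N Real.pi 0 = ((N : ℝ) - 1) * (8 - (N : ℝ)) ∧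
      1 / 2 + (((N : ℝ) - 1) * (8 - (N : ℝ))) / (2 * (N : ℝ) * ((N : ℝ) + 1)) -
          (N : ℝ) / ((N : ℝ) + 1) =
        (if N = 2 then (1 / 3 : ℝ) else 1 / 6) := by
  refine ⟨⟨⟨(Real.pi, 0), gFun_pi_zero hN⟩, ?_⟩, gFun_pi_zero hN, ?_⟩
  · rintro _ ⟨tp, rfl⟩
    exact gFun_le hN tp.1 tp.2
  · rcases hN with rfl | rfl <;> norm_num
end

section
/- Symmetric input states are optimal: for every integer N ≥ 2, all θ, φ, ψ ∈ ℝ, and every p : Fin N → ℝ with p_i ≥ 0 and ∑_i p_i = 1, letting √D denote the diagonal 2N×2N matrix with entry √p_i at index ((i,s),(i,s)), the sum of the absolute values of the eigenvalues of the Hermitian matrix √D · M(θ,φ,ψ) · √D is at most (1/N) times the sum of the absolute values of the eigenvalues of M(θ,φ,ψ). -/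
/-- The diagonal matrix `√D` with entry `√p_i` at index `((i,s),(i,s))`. -/
noncomputable def sqrtD (N : ℕ) (p : Fin N → ℝ) :
    Matrix (Fin N × Fin 2) (Fin N × Fin 2) ℂ :=
  Matrix.diagonal fun ik : Fin N × Fin 2 => ((Real.sqrt (p ik.1) : ℝ) : ℂ)

open Matrix
open scoped ComplexOrder

/-- If every eigenvalue of a Hermitian matrix is at least `-c`, so is its quadratic form. -/
lemma Matrix.IsHermitian.neg_mul_le_re_star_dotProduct_mulVec {n : Type*} [Fintype n]
    [DecidableEq n] {H : Matrix n n ℂ} (hH : H.IsHermitian) {c : ℝ}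
    (hc : ∀ i, -c ≤ hH.eigenvalues i) (x : n → ℂ) :
    -(c * ∑ i, ‖x i‖ ^ 2) ≤ (star x ⬝ᵥ H *ᵥ x).re := by
  have hpsd : (H + (c : ℂ) • (1 : Matrix n n ℂ)).PosSemidef := by
    have key : H + (c : ℂ) • (1 : Matrix n n ℂ) = (hH.eigenvectorUnitary : Matrix n n ℂ) *
        diagonal (fun i => ((hH.eigenvalues i + c : ℝ) : ℂ)) *
          (hH.eigenvectorUnitary : Matrix n n ℂ)ᴴ := by
      have hd : diagonal (fun i => ((hH.eigenvalues i + c : ℝ) : ℂ)) =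
          diagonal (RCLike.ofReal ∘ hH.eigenvalues) + (c : ℂ) • (1 : Matrix n n ℂ) := by
        ext i j
        by_cases h : i = j <;> simp [h, diagonal]
      have hU : (hH.eigenvectorUnitary : Matrix n n ℂ) *
          (hH.eigenvectorUnitary : Matrix n n ℂ)ᴴ = 1 :=
        Unitary.mul_star_self_of_mem hH.eigenvectorUnitary.2
      rw [hd, mul_add, add_mul, mul_smul_comm, smul_mul_assoc, mul_one, hU]
      congr 1
      conv_lhs => rw [hH.spectral_theorem, Unitary.conjStarAlgAut_apply]
      rfl
    rw [key]
    refine (PosSemidef.diagonal fun i => ?_).mul_mul_conjTranspose_same _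
    have := hc i
    simp only [Pi.zero_apply]
    exact_mod_cast (by linarith : (0 : ℝ) ≤ hH.eigenvalues i + c)
  have h := hpsd.re_dotProduct_nonneg x
  have hx : (star x ⬝ᵥ x).re = ∑ i, ‖x i‖ ^ 2 := by
    simp only [dotProduct, Pi.star_apply, Complex.re_sum]
    refine Finset.sum_congr rfl fun i _ => ?_
    rw [← Complex.normSq_eq_norm_sq, Complex.normSq_apply]
    simp
  rw [add_mulVec, smul_mulVec, one_mulVec, dotProduct_add, dotProduct_smul] at h
  simp only [smul_eq_mul, RCLike.re_to_complex, Complex.add_re, Complex.re_ofReal_mul, hx] at h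
  linarith

/-- A Hermitian matrix whose quadratic form is nonnegative on a hyperplane has at most one
negative eigenvalue. -/
lemma Matrix.IsHermitian.eq_of_eigenvalues_neg {n : Type*} [Fintype n] [DecidableEq n]
    {H : Matrix n n ℂ} (hH : H.IsHermitian) (v : n → ℂ)
    (hv : ∀ x, v ⬝ᵥ x = 0 → 0 ≤ (star x ⬝ᵥ H *ᵥ x).re) {i j : n}
    (hi : hH.eigenvalues i < 0) (hj : hH.eigenvalues j < 0) : i = j := by
  by_contra hij
  have hu (k l : n) : star (hH.eigenvectorBasis k).ofLp ⬝ᵥ (hH.eigenvectorBasis l).ofLp =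
      if k = l then 1 else 0 := by
    rw [dotProduct_comm, ← EuclideanSpace.inner_eq_star_dotProduct,
      OrthonormalBasis.inner_eq_ite]
  have form (a b : ℂ) : (star (a • (hH.eigenvectorBasis i).ofLp +
      b • (hH.eigenvectorBasis j).ofLp) ⬝ᵥ H *ᵥ (a • (hH.eigenvectorBasis i).ofLp +
      b • (hH.eigenvectorBasis j).ofLp)).re =
      Complex.normSq a * hH.eigenvalues i + Complex.normSq b * hH.eigenvalues j := by
    rw [mulVec_add, mulVec_smul, mulVec_smul, hH.mulVec_eigenvectorBasis,
      hH.mulVec_eigenvectorBasis]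
    simp only [star_add, star_smul, add_dotProduct, dotProduct_add, smul_dotProduct,
      dotProduct_smul, hu, hij, Ne.symm hij, if_true, if_false]
    simp [Complex.normSq_apply]
    ring
  set p := v ⬝ᵥ (hH.eigenvectorBasis i).ofLp with hp
  set q := v ⬝ᵥ (hH.eigenvectorBasis j).ofLp with hq
  by_cases h : p = 0
  · have := hv ((1 : ℂ) • (hH.eigenvectorBasis i).ofLp + (0 : ℂ) • (hH.eigenvectorBasis j).ofLp)
      (by simp [← hp, h])
    rw [form] at this
    simp at this
    linarith
  · have := hv (q • (hH.eigenvectorBasis i).ofLp + (-p) • (hH.eigenvectorBasis j).ofLp)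
      (by simp only [dotProduct_add, dotProduct_smul, ← hp, ← hq, smul_eq_mul]; ring)
    rw [form, Complex.normSq_neg] at this
    nlinarith [Complex.normSq_pos.2 h, Complex.normSq_nonneg q]

/-- The trace norm of a Hermitian matrix with at most one negative eigenvalue. -/
lemma Matrix.IsHermitian.sum_abs_eigenvalues_le {n : Type*} [Fintype n] [DecidableEq n]
    {H : Matrix n n ℂ} (hH : H.IsHermitian) (v : n → ℂ)
    (hv : ∀ x, v ⬝ᵥ x = 0 → 0 ≤ (star x ⬝ᵥ H *ᵥ x).re) {c : ℝ} (hc0 : 0 ≤ c)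
    (hc : ∀ x, -(c * ∑ i, ‖x i‖ ^ 2) ≤ (star x ⬝ᵥ H *ᵥ x).re) :
    ∑ i, |hH.eigenvalues i| ≤ H.trace.re + 2 * c := by
  have hlow (i : n) : -c ≤ hH.eigenvalues i := by
    have h := hc (hH.eigenvectorBasis i).ofLp
    rw [← EuclideanSpace.norm_sq_eq, OrthonormalBasis.norm_eq_one] at h
    rw [hH.eigenvalues_eq]
    simpa using h
  have hneg : ∑ i, max (-hH.eigenvalues i) 0 ≤ c := by
    by_cases hex : ∃ i, hH.eigenvalues i < 0
    · obtain ⟨i, hi⟩ := hex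
      rw [Finset.sum_eq_single i]
      · exact max_le (by linarith [hlow i]) hc0
      · intro j _ hji
        refine max_eq_right ?_
        by_contra hj
        exact hji (hH.eq_of_eigenvalues_neg v hv (by linarith) hi)
      · simp
    · push Not at hex
      rw [Finset.sum_eq_zero fun i _ => max_eq_right (by linarith [hex i])]
      exact hc0
  have habs (t : ℝ) : |t| = t + 2 * max (-t) 0 := by
    rcases le_total 0 t with h | h
    · rw [abs_of_nonneg h, max_eq_right (by linarith)]; ring
    · rw [abs_of_nonpos h, max_eq_left (by linarith)]; ring
  have htr : H.trace.re = ∑ i, hH.eigenvalues i := by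
    rw [hH.trace_eq_sum_eigenvalues]; simp
  simp only [habs, Finset.sum_add_distrib, ← Finset.mul_sum, htr]
  linarith

/-- The trace norm bounds the quadratic form of a Hermitian matrix from below. -/
lemma Matrix.IsHermitian.neg_half_mul_le_re_star_dotProduct_mulVec {n : Type*} [Fintype n]
    [DecidableEq n] {H : Matrix n n ℂ} (hH : H.IsHermitian) (x : n → ℂ) :
    -((∑ i, |hH.eigenvalues i| - H.trace.re) / 2 * ∑ i, ‖x i‖ ^ 2) ≤
      (star x ⬝ᵥ H *ᵥ x).re := by
  refine hH.neg_mul_le_re_star_dotProduct_mulVec (fun i => ?_) x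
  have htr : H.trace.re = ∑ i, hH.eigenvalues i := by
    rw [hH.trace_eq_sum_eigenvalues]; simp
  rw [htr, ← Finset.sum_sub_distrib]
  have h := Finset.single_le_sum
    (f := fun i => |hH.eigenvalues i| - hH.eigenvalues i)
    (fun j _ => sub_nonneg.2 (le_abs_self _)) (Finset.mem_univ i)
  have := neg_abs_le (hH.eigenvalues i)
  linarith

/-- The linear functional whose squared modulus is the quadratic form of `matA - matB`. -/
noncomputable def diffForm (θ φ ψ : ℝ) (y : Fin 2 → ℂ) : ℂ :=
  (1 - Real.cos θ * Complex.exp (-Complex.I * φ)) * y 0 -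
    Real.sin θ * Complex.exp (-Complex.I * ψ) * y 1

lemma diffForm_sum {ι : Type*} (s : Finset ι) (θ φ ψ : ℝ) (y : ι → Fin 2 → ℂ) :
    diffForm θ φ ψ (∑ i ∈ s, y i) = ∑ i ∈ s, diffForm θ φ ψ (y i) := by
  simp [diffForm, Finset.mul_sum, Finset.sum_sub_distrib]

lemma star_dotProduct_matA_mulVec (N : ℕ) (θ φ ψ : ℝ) (y : Fin 2 → ℂ) :
    star y ⬝ᵥ matA N θ φ ψ *ᵥ y =
      (‖diffForm θ φ ψ y‖ ^ 2 : ℝ) + star y ⬝ᵥ matB N θ φ ψ *ᵥ y := by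
  have hn (z : ℂ) : ((‖z‖ ^ 2 : ℝ) : ℂ) = star z * z := by
    rw [← Complex.normSq_eq_norm_sq, Complex.normSq_eq_conj_mul_self]; rfl
  have hconj (t : ℝ) : (starRingEnd ℂ) (Complex.exp (-Complex.I * t)) =
      Complex.exp (Complex.I * t) := by
    rw [← Complex.exp_conj]; simp
  have h1 (t : ℝ) : Complex.exp (Complex.I * t) * Complex.exp (-Complex.I * t) = 1 := by
    rw [← Complex.exp_add]; simp
  have h2 (t : ℝ) : (2 * Real.cos t : ℂ) = Complex.exp (Complex.I * t) +
      Complex.exp (-Complex.I * t) := by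
    rw [Complex.ofReal_cos, Complex.two_cos]
    ring_nf
  have h3 : Complex.exp (Complex.I * ((φ - ψ : ℝ) : ℂ)) =
      Complex.exp (Complex.I * φ) * Complex.exp (-Complex.I * ψ) := by
    rw [← Complex.exp_add]; push_cast; ring_nf
  have h4 : Complex.exp (-Complex.I * ((φ - ψ : ℝ) : ℂ)) =
      Complex.exp (-Complex.I * φ) * Complex.exp (Complex.I * ψ) := by
    rw [← Complex.exp_add]; push_cast; ring_nf
  have h00 : ((2 * Real.cos θ * Real.cos φ + (N : ℝ) - 3 : ℝ) : ℂ) =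
      Real.cos θ * (Complex.exp (Complex.I * φ) + Complex.exp (-Complex.I * φ)) + N - 3 := by
    rw [← h2]; push_cast; ring
  rw [hn]
  simp only [matA, matB, diffForm, h3, h4, h00, dotProduct, mulVec, Fin.sum_univ_two,
    Pi.star_apply, RCLike.star_def, map_sub, map_mul, map_one, hconj, Complex.conj_ofReal,
    of_apply, cons_val_zero, cons_val_one, cons_val', cons_val_fin_one]
  push_cast
  linear_combination (-(Complex.cos θ ^ 2 * (starRingEnd ℂ) (y 0) * y 0)) * h1 φ -
    Complex.sin θ ^ 2 * (starRingEnd ℂ) (y 1) * y 1 * h1 ψ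

/-- The quadratic form of `matM`. -/
lemma re_star_dotProduct_matM_mulVec (N : ℕ) (θ φ ψ : ℝ) (z : Fin N × Fin 2 → ℂ) :
    (star z ⬝ᵥ matM N θ φ ψ *ᵥ z).re =
      ∑ i, ‖diffForm θ φ ψ (fun s => z (i, s))‖ ^ 2 +
        (star (∑ i, fun s => z (i, s)) ⬝ᵥ matB N θ φ ψ *ᵥ (∑ i, fun s => z (i, s))).re := by
  have hM : matM N θ φ ψ *ᵥ z = fun ik => (matA N θ φ ψ *ᵥ fun s => z (ik.1, s)) ik.2 -
      (matB N θ φ ψ *ᵥ fun s => z (ik.1, s)) ik.2 +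
        (matB N θ φ ψ *ᵥ ∑ i, fun s => z (i, s)) ik.2 := by
    ext ⟨i, k⟩
    have (j : Fin N) (s : Fin 2) : matM N θ φ ψ (i, k) (j, s) =
        (if i = j then matA N θ φ ψ k s - matB N θ φ ψ k s else 0) + matB N θ φ ψ k s := by
      by_cases h : i = j <;> simp [matM, h]
    simp [mulVec, dotProduct, Fintype.sum_prod_type, this, add_mul, sub_mul,
      Finset.sum_add_distrib, Finset.mul_sum]
  have h : star z ⬝ᵥ matM N θ φ ψ *ᵥ z =
      ((∑ i, ‖diffForm θ φ ψ (fun s => z (i, s))‖ ^ 2 : ℝ) : ℂ) +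
        star (∑ i, fun s => z (i, s)) ⬝ᵥ matB N θ φ ψ *ᵥ (∑ i, fun s => z (i, s)) := by
    have hA (i : Fin N) := star_dotProduct_matA_mulVec N θ φ ψ (fun s => z (i, s))
    rw [hM, Complex.ofReal_sum, ← Finset.sum_congr rfl fun i _ => sub_eq_of_eq_add (hA i),
      star_sum, sum_dotProduct, ← Finset.sum_add_distrib]
    simp only [dotProduct, Fintype.sum_prod_type]
    refine Finset.sum_congr rfl fun i _ => ?_
    rw [← Finset.sum_sub_distrib, ← Finset.sum_add_distrib]
    refine Finset.sum_congr rfl fun k _ => ?_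
    simp only [Pi.star_apply]
    ring
  rw [h, Complex.add_re, Complex.ofReal_re]

lemma star_dotProduct_matB_mulVec_eq_zero (N : ℕ) (θ φ ψ : ℝ) {y : Fin 2 → ℂ} (hy : y 0 = 0) :
    star y ⬝ᵥ matB N θ φ ψ *ᵥ y = 0 := by
  simp [matB, dotProduct, mulVec, Fin.sum_univ_two, hy]

lemma star_dotProduct_sqrtD_mul_mul_mulVec (N : ℕ) (p : Fin N → ℝ)
    (M : Matrix (Fin N × Fin 2) (Fin N × Fin 2) ℂ) (x : Fin N × Fin 2 → ℂ) :
    star x ⬝ᵥ (sqrtD N p * M * sqrtD N p) *ᵥ x =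
      star (sqrtD N p *ᵥ x) ⬝ᵥ M *ᵥ (sqrtD N p *ᵥ x) := by
  have hS : (sqrtD N p)ᴴ = sqrtD N p := by
    simp only [sqrtD, diagonal_conjTranspose]
    congr 1
    ext i
    simp
  rw [star_mulVec, hS, ← mulVec_mulVec, ← mulVec_mulVec, dotProduct_mulVec]

/-- Averaging over the blocks: a lower bound for the quadratic form of `matM` in terms of the
block sum. -/
lemma neg_mul_le_re_star_dotProduct_matM_mulVec {N : ℕ} (hN : 0 < N) (θ φ ψ : ℝ) {c : ℝ}
    (hc : ∀ x, -(c * ∑ i, ‖x i‖ ^ 2) ≤ (star x ⬝ᵥ matM N θ φ ψ *ᵥ x).re)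
    (z : Fin N × Fin 2 → ℂ) :
    -(c / N * ∑ s, ‖∑ i, z (i, s)‖ ^ 2) ≤ (star z ⬝ᵥ matM N θ φ ψ *ᵥ z).re := by
  have hN' : (0 : ℝ) < N := by exact_mod_cast hN
  set Y : Fin 2 → ℂ := ∑ i, fun s => z (i, s) with hY
  have h := hc fun ik => Y ik.2
  rw [re_star_dotProduct_matM_mulVec] at h ⊢
  have hYs (s : Fin 2) : ∑ i, z (i, s) = Y s := by simp [hY]
  simp only [hYs, ← hY]
  have hconst : (∑ _i : Fin N, fun s => Y s) = (N : ℂ) • Y := by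
    ext s; simp
  have hcs : ‖diffForm θ φ ψ Y‖ ^ 2 ≤ N * ∑ i, ‖diffForm θ φ ψ (fun s => z (i, s))‖ ^ 2 := by
    calc ‖diffForm θ φ ψ Y‖ ^ 2 ≤ (∑ i, ‖diffForm θ φ ψ (fun s => z (i, s))‖) ^ 2 := by
          rw [hY, diffForm_sum]
          gcongr
          exact norm_sum_le _ _
      _ ≤ _ := by simpa using sq_sum_le_card_mul_sum_sq (s := Finset.univ)
                    (f := fun i => ‖diffForm θ φ ψ (fun s => z (i, s))‖)
  rw [hconst, mulVec_smul, star_smul, smul_dotProduct, dotProduct_smul,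
    star_natCast] at h
  simp only [Fintype.sum_prod_type, Finset.sum_const, Finset.card_univ, Fintype.card_fin,
    nsmul_eq_mul, smul_eq_mul, ← Complex.ofReal_natCast,
    Complex.re_ofReal_mul] at h
  set Q := (star Y ⬝ᵥ matB N θ φ ψ *ᵥ Y).re
  set T := ∑ i, ‖diffForm θ φ ψ (fun s => z (i, s))‖ ^ 2
  set R := ∑ s, ‖Y s‖ ^ 2
  change -(c * (N * R)) ≤ N * ‖diffForm θ φ ψ Y‖ ^ 2 + N * (N * Q) at h
  have h' : -(c * R) ≤ ‖diffForm θ φ ψ Y‖ ^ 2 + N * Q := by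
    refine le_of_mul_le_mul_left ?_ hN'
    linarith
  have : -(c * R) ≤ N * (T + Q) := by linarith
  rw [div_mul_eq_mul_div, neg_le, le_div_iff₀ hN']
  linarith

/-- Cauchy-Schwarz for the block sum of `sqrtD *ᵥ x`. -/
lemma sum_norm_sq_blockSum_sqrtD_le (N : ℕ) (p : Fin N → ℝ) (hp0 : ∀ i, 0 ≤ p i)
    (hp1 : ∑ i, p i = 1) (x : Fin N × Fin 2 → ℂ) :
    ∑ s, ‖∑ i, (sqrtD N p *ᵥ x) (i, s)‖ ^ 2 ≤ ∑ k, ‖x k‖ ^ 2 := by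
  rw [Fintype.sum_prod_type, Finset.sum_comm]
  refine Finset.sum_le_sum fun s _ => ?_
  calc ‖∑ i, (sqrtD N p *ᵥ x) (i, s)‖ ^ 2
      ≤ (∑ i, √(p i) * ‖x (i, s)‖) ^ 2 := by
        gcongr
        refine (norm_sum_le _ _).trans_eq (Finset.sum_congr rfl fun i _ => ?_)
        simp [sqrtD, mulVec_diagonal, abs_of_nonneg (Real.sqrt_nonneg _)]
    _ ≤ (∑ i, √(p i) ^ 2) * ∑ i, ‖x (i, s)‖ ^ 2 := Finset.sum_mul_sq_le_sq_mul_sq _ _ _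
    _ = ∑ i, ‖x (i, s)‖ ^ 2 := by simp [Real.sq_sqrt (hp0 _), hp1]

lemma trace_matM (N : ℕ) (θ φ ψ : ℝ) : (matM N θ φ ψ).trace = N * (matA N θ φ ψ).trace := by
  simp [trace, matM, Fintype.sum_prod_type]
  ring

lemma trace_sqrtD_mul_matM_mul_sqrtD (N : ℕ) (θ φ ψ : ℝ) (p : Fin N → ℝ)
    (hp0 : ∀ i, 0 ≤ p i) (hp1 : ∑ i, p i = 1) :
    (sqrtD N p * matM N θ φ ψ * sqrtD N p).trace = (matA N θ φ ψ).trace := by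
  have h (i : Fin N) (a : ℂ) : (√(p i) : ℂ) * a * √(p i) = p i * a := by
    rw [mul_right_comm, ← Complex.ofReal_mul, Real.mul_self_sqrt (hp0 i)]
  simp only [trace, diag_apply, sqrtD, mul_diagonal, diagonal_mul, Fintype.sum_prod_type, matM,
    if_true, h]
  rw [Finset.sum_comm]
  simp [← Finset.sum_mul, ← Complex.ofReal_sum, hp1]

/-- symmetric input states are optimal: for every probability vector `p`,
the trace norm of `√D · M(θ,φ,ψ) · √D` is at most `1/N` times the trace norm of
`M(θ,φ,ψ)`. -/
theorem stmt16 (N : ℕ) (hN : 2 ≤ N) (θ φ ψ : ℝ) (p : Fin N → ℝ)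
    (hp0 : ∀ i, 0 ≤ p i) (hp1 : (∑ i, p i) = 1)
    (hM : (matM N θ φ ψ).IsHermitian)
    (hM' : (sqrtD N p * matM N θ φ ψ * sqrtD N p).IsHermitian) :
    (∑ i, |hM'.eigenvalues i|) ≤ (1 / (N : ℝ)) * ∑ i, |hM.eigenvalues i| := by
  have hN0 : 0 < N := by omega
  have hN' : (0 : ℝ) < N := by exact_mod_cast hN0
  set S := ∑ i, |hM.eigenvalues i| with hS
  set t := (matA N θ φ ψ).trace.re with ht
  have htM : (matM N θ φ ψ).trace.re = N * t := by
    rw [trace_matM, ← Complex.ofReal_natCast, Complex.re_ofReal_mul]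
  have hc0 : 0 ≤ (S - N * t) / 2 := by
    have : N * t = ∑ i, hM.eigenvalues i := by
      rw [← htM, hM.trace_eq_sum_eigenvalues]; simp
    rw [this, hS, ← Finset.sum_sub_distrib]
    exact div_nonneg (Finset.sum_nonneg fun i _ => sub_nonneg.2 (le_abs_self _)) (by norm_num)
  have hc := hM.neg_half_mul_le_re_star_dotProduct_mulVec
  rw [htM, ← hS] at hc
  have hmain := hM'.sum_abs_eigenvalues_le
    (fun ik => if ik.2 = 0 then (√(p ik.1) : ℂ) else 0) (c := (S - N * t) / 2 / N) ?_
    (div_nonneg hc0 hN'.le) ?_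
  · rw [trace_sqrtD_mul_matM_mul_sqrtD N θ φ ψ p hp0 hp1, ← ht] at hmain
    refine hmain.trans_eq ?_
    field_simp
    ring
  · intro x hx
    rw [star_dotProduct_sqrtD_mul_mul_mulVec, re_star_dotProduct_matM_mulVec,
      star_dotProduct_matB_mulVec_eq_zero]
    · simp only [Complex.zero_re, add_zero]
      positivity
    · rw [← hx]
      simp [sqrtD, mulVec_diagonal, dotProduct, Fintype.sum_prod_type]
  · intro x
    rw [star_dotProduct_sqrtD_mul_mul_mulVec]
    refine le_trans (neg_le_neg ?_)
      (neg_mul_le_re_star_dotProduct_matM_mulVec hN0 θ φ ψ hc (sqrtD N p *ᵥ x))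
    exact mul_le_mul_of_nonneg_left (sum_norm_sq_blockSum_sqrtD_le N p hp0 hp1 x)
      (div_nonneg hc0 hN'.le)
end

section
/- Maximal violation of the fingerprinting inequality by second-order interference behaviors (Theorem 2): for every integer N > 3, the set { F_N(p) | p ∈ J_{N,2} } has greatest element N/(N+1) + 2/((N−2)(N−1)(N+1)). Moreover the maximum is attained by a behavior p with 1 − p(0,…,0) = 2/(N²−3N+2) and p(e_k) = 1 for all k = 1,…,N. -/
/-- The Fourier coefficient `p̂(S) = 2^{−N} ∑_x (−1)^{∑_{i∈S} x_i} p(x)`. -/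
noncomputable def bFourier {N : ℕ} (p : (Fin N → Bool) → ℝ) (S : Finset (Fin N)) : ℝ :=
  (∑ x : Fin N → Bool,
    (-1 : ℝ) ^ (S.filter (fun i => x i = true)).card * p x) / 2 ^ N

/-- The `K`th-order interference set `J_{N,K}`: all `p : {0,1}^N → [0,1]` with
`p̂(S) = 0` for every `S` with `|S| > K`. -/
def InterfSet (N K : ℕ) : Set ((Fin N → Bool) → ℝ) :=
  { p | (∀ x, p x ∈ Set.Icc (0 : ℝ) 1) ∧
    ∀ S : Finset (Fin N), K < S.card → bFourier p S = 0 }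

/-- The character `χ_S(x) = ∏_{i ∈ S} (−1)^{x_i}` of the Boolean cube. -/
def boolChar {N : ℕ} (S : Finset (Fin N)) (x : Fin N → Bool) : ℝ :=
  ∏ i ∈ S, if x i = true then -1 else 1

theorem boolChar_eq_pow {N : ℕ} (S : Finset (Fin N)) (x : Fin N → Bool) :
    boolChar S x = (-1 : ℝ) ^ (S.filter (fun i => x i = true)).card := by
  simp [boolChar, Finset.prod_ite]

theorem bFourier_eq_sum_boolChar {N : ℕ} (p : (Fin N → Bool) → ℝ) (S : Finset (Fin N)) :
    bFourier p S = (∑ x, boolChar S x * p x) / 2 ^ N := by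
  simp [bFourier, boolChar_eq_pow]

theorem sum_boolChar_mul_boolChar {N : ℕ} (x y : Fin N → Bool) :
    ∑ S, boolChar S y * boolChar S x = if y = x then 2 ^ N else 0 := by
  have h : ∑ S, boolChar S y * boolChar S x =
      ∏ i, (1 + (if y i = true then (-1 : ℝ) else 1) * (if x i = true then -1 else 1)) := by
    rw [Finset.prod_one_add, Finset.powerset_univ]
    simp only [boolChar, Finset.prod_mul_distrib]
  rw [h]
  split_ifs with hxy
  · subst hxy
    rw [Finset.prod_congr rfl (g := fun _ => (2 : ℝ))]
    · simp
    · intro i _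
      split_ifs <;> norm_num
  · obtain ⟨i, hi⟩ := Function.ne_iff.mp hxy
    refine Finset.prod_eq_zero (Finset.mem_univ i) ?_
    cases hy : y i <;> cases hx : x i <;> simp_all

/-- Fourier inversion on the Boolean cube. -/
theorem eq_sum_bFourier_smul_boolChar {N : ℕ} (p : (Fin N → Bool) → ℝ) :
    p = ∑ S, bFourier p S • boolChar S := by
  ext x
  have h : ∑ S, bFourier p S * boolChar S x =
      (∑ y, p y * ∑ S, boolChar S y * boolChar S x) / 2 ^ N := by
    simp_rw [bFourier_eq_sum_boolChar, Finset.mul_sum, Finset.sum_div, Finset.sum_mul]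
    rw [Finset.sum_comm]
    refine Finset.sum_congr rfl fun y _ => Finset.sum_congr rfl fun S _ => ?_
    ring
  simp [h, sum_boolChar_mul_boolChar]

theorem boolChar_false {N : ℕ} (S : Finset (Fin N)) : boolChar S (fun _ => false) = 1 := by
  simp [boolChar]

theorem boolChar_true {N : ℕ} (S : Finset (Fin N)) :
    boolChar S (fun _ => true) = (-1) ^ S.card := by
  simp [boolChar]

theorem boolChar_xor {N : ℕ} (S : Finset (Fin N)) (x y : Fin N → Bool) :
    boolChar S (fun i => xor (x i) (y i)) = boolChar S x * boolChar S y := by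
  rw [boolChar, boolChar, boolChar, ← Finset.prod_mul_distrib]
  refine Finset.prod_congr rfl fun i _ => ?_
  cases x i <;> cases y i <;> simp

theorem boolChar_single {N : ℕ} (S : Finset (Fin N)) (k : Fin N) :
    boolChar S (fun i => decide (i = k)) = 1 - 2 * if k ∈ S then 1 else 0 := by
  simp only [boolChar, decide_eq_true_eq, Finset.prod_ite_eq']
  split_ifs <;> norm_num

theorem sum_boolChar_single {N : ℕ} (S : Finset (Fin N)) :
    ∑ k, boolChar S (fun i => decide (i = k)) = N - 2 * S.card := by
  simp [boolChar_single, Finset.sum_sub_distrib, mul_comm]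

theorem sum_sum_boolChar_xor_single {N : ℕ} (S : Finset (Fin N)) :
    ∑ j, ∑ k, boolChar S (fun i => xor (decide (i = j)) (decide (i = k))) =
      (N - 2 * S.card : ℝ) ^ 2 := by
  simp_rw [boolChar_xor, ← Finset.mul_sum, ← Finset.sum_mul, sum_boolChar_single]
  ring

/-- Interpolation identity expressing `p(0)` through the values of a second-order `p` at weights
one, two and `N`. -/
theorem interpolation_of_bFourier_eq_zero {N : ℕ} (p : (Fin N → Bool) → ℝ)
    (hp : ∀ S : Finset (Fin N), 2 < S.card → bFourier p S = 0) :
    ((N : ℝ) - 1) * (N - 2) * p (fun _ => false) =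
      2 * (N - 2) * ∑ k, p (fun i => decide (i = k)) -
        (∑ j, ∑ k, p (fun i => xor (decide (i = j)) (decide (i = k))) -
          N * p (fun _ => false)) + 2 * p (fun _ => true) := by
  let ev (x : Fin N → Bool) : ((Fin N → Bool) → ℝ) →ₗ[ℝ] ℝ := LinearMap.proj x
  let L : ((Fin N → Bool) → ℝ) →ₗ[ℝ] ℝ :=
    (((N : ℝ) - 1) * (N - 2) - N) • ev (fun _ => false) -
      (2 * ((N : ℝ) - 2)) • ∑ k, ev (fun i => decide (i = k)) +
      ∑ j, ∑ k, ev (fun i => xor (decide (i = j)) (decide (i = k))) -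
      (2 : ℝ) • ev (fun _ => true)
  have hL (f : (Fin N → Bool) → ℝ) : L f =
      (((N : ℝ) - 1) * (N - 2) - N) * f (fun _ => false) -
        2 * (N - 2) * ∑ k, f (fun i => decide (i = k)) +
        ∑ j, ∑ k, f (fun i => xor (decide (i = j)) (decide (i = k))) -
        2 * f (fun _ => true) := by
    simp [L, ev, LinearMap.sum_apply]
  have h0 : L p = 0 := by
    rw [eq_sum_bFourier_smul_boolChar p, map_sum]
    refine Finset.sum_eq_zero fun S _ => ?_
    rw [map_smul, smul_eq_mul]
    by_cases hS : 2 < S.card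
    · rw [hp S hS, zero_mul]
    · rw [hL, boolChar_false, boolChar_true, sum_boolChar_single, sum_sum_boolChar_xor_single]
      refine mul_eq_zero_of_right _ ?_
      interval_cases S.card <;> push_cast <;> ring
  rw [hL] at h0
  linarith

theorem sum_boolChar_mul_eq_zero {N : ℕ} {S : Finset (Fin N)} {l : Fin N} (hl : l ∈ S)
    (f : (Fin N → Bool) → ℝ) (hf : ∀ x b, f (Function.update x l b) = f x) :
    ∑ x, boolChar S x * f x = 0 := by
  refine Finset.sum_involution (fun x _ => Function.update x l (!x l)) ?_ ?_
    (fun _ _ => Finset.mem_univ _) ?_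
  · intro x _
    have h : boolChar S (Function.update x l (!x l)) = -boolChar S x := by
      rw [boolChar, boolChar, ← Finset.mul_prod_erase S _ hl, ← Finset.mul_prod_erase S _ hl,
        ← neg_mul]
      congr 1
      · cases h : x l <;> simp
      · refine Finset.prod_congr rfl fun i hi => ?_
        rw [Function.update_of_ne (Finset.ne_of_mem_erase hi)]
    rw [hf, h]
    ring
  · intro x _ _ h
    have := congrFun h l
    simp at this
  · intro x _
    simp

/-- The Hamming weight of a bit string, as a real number. -/
def boolWeight {N : ℕ} (x : Fin N → Bool) : ℝ := ∑ i, if x i = true then 1 else 0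

theorem boolWeight_eq_card {N : ℕ} (x : Fin N → Bool) :
    boolWeight x = (Finset.univ.filter (fun i => x i = true)).card := by
  simp [boolWeight]

theorem boolWeight_single {N : ℕ} (k : Fin N) : boolWeight (fun i => decide (i = k)) = 1 := by
  simp [boolWeight]

theorem boolWeight_false {N : ℕ} : boolWeight (fun _ : Fin N => false) = 0 := by
  simp [boolWeight]

theorem bFourier_quadratic_boolWeight {N : ℕ} (a b c : ℝ) {S : Finset (Fin N)}
    (hS : 2 < S.card) :
    bFourier (fun x => a + b * boolWeight x + c * boolWeight x ^ 2) S = 0 := by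
  have hpair (i j : Fin N) : ∃ l ∈ S, i ≠ l ∧ j ≠ l := by
    obtain ⟨l, hl, hl'⟩ := Finset.exists_mem_notMem_of_card_lt_card
      (lt_of_le_of_lt (Finset.card_le_two (a := i) (b := j)) hS)
    simp only [Finset.mem_insert, Finset.mem_singleton, not_or] at hl'
    exact ⟨l, hl, Ne.symm hl'.1, Ne.symm hl'.2⟩
  have h0 : ∑ x, boolChar S x = 0 := by
    obtain ⟨l, hl⟩ := Finset.card_pos.mp (Nat.zero_lt_of_lt hS)
    simpa using sum_boolChar_mul_eq_zero hl (fun _ => 1) (by simp)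
  have h1 : ∑ x, boolChar S x * boolWeight x = 0 := by
    simp_rw [boolWeight, Finset.mul_sum]
    rw [Finset.sum_comm]
    refine Finset.sum_eq_zero fun i _ => ?_
    obtain ⟨l, hl, hi, -⟩ := hpair i i
    exact sum_boolChar_mul_eq_zero hl (fun x => if x i = true then 1 else 0) (by simp [hi])
  have h2 : ∑ x, boolChar S x * boolWeight x ^ 2 = 0 := by
    simp_rw [boolWeight, sq, Finset.sum_mul_sum, Finset.mul_sum]
    rw [Finset.sum_comm]
    refine Finset.sum_eq_zero fun i _ => ?_
    rw [Finset.sum_comm]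
    refine Finset.sum_eq_zero fun j _ => ?_
    obtain ⟨l, hl, hi, hj⟩ := hpair i j
    exact sum_boolChar_mul_eq_zero hl
      (fun x => (if x i = true then 1 else 0) * (if x j = true then 1 else 0)) (by simp [hi, hj])
  have h : ∑ x, boolChar S x * (a + b * boolWeight x + c * boolWeight x ^ 2) =
      a * ∑ x, boolChar S x + b * ∑ x, boolChar S x * boolWeight x +
        c * ∑ x, boolChar S x * boolWeight x ^ 2 := by
    simp_rw [Finset.mul_sum, ← Finset.sum_add_distrib]
    exact Finset.sum_congr rfl fun x _ => by ring
  rw [bFourier_eq_sum_boolChar, h, h0, h1, h2]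
  simp

/-- The optimal second-order behavior `1 − (|x| − 1)(|x| − 2) / ((N − 1)(N − 2))`. -/
noncomputable def optBehavior (N : ℕ) (x : Fin N → Bool) : ℝ :=
  1 - (boolWeight x - 1) * (boolWeight x - 2) / (((N : ℝ) - 1) * (N - 2))

theorem optBehavior_mem_interfSet {N : ℕ} (hN : 3 < N) : optBehavior N ∈ InterfSet N 2 := by
  have hN' : (4 : ℝ) ≤ N := by exact_mod_cast hN
  have hD : 0 < ((N : ℝ) - 1) * (N - 2) := mul_pos (by linarith) (by linarith)
  refine ⟨fun x => ?_, fun S hS => ?_⟩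
  · obtain ⟨k, hk, hkN⟩ : ∃ k : ℕ, boolWeight x = k ∧ k ≤ N :=
      ⟨_, boolWeight_eq_card x, (Finset.card_le_univ _).trans_eq (Fintype.card_fin N)⟩
    have hkN' : (k : ℝ) ≤ N := by exact_mod_cast hkN
    rw [optBehavior, hk, Set.mem_Icc, sub_nonneg, div_le_one hD, sub_le_self_iff]
    rcases k with _ | _ | k
    · refine ⟨?_, by positivity⟩
      norm_num
      nlinarith
    · norm_num
      exact hD.le
    · push_cast at hkN' ⊢
      have hk0 : (0 : ℝ) ≤ k := k.cast_nonneg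
      exact ⟨by nlinarith, div_nonneg (by nlinarith) hD.le⟩
  · rw [← bFourier_quadratic_boolWeight (1 - 2 / (((N : ℝ) - 1) * (N - 2)))
      (3 / (((N : ℝ) - 1) * (N - 2))) (-1 / (((N : ℝ) - 1) * (N - 2))) hS]
    congr 1
    ext x
    rw [optBehavior]
    ring

theorem optBehavior_single {N : ℕ} (k : Fin N) :
    optBehavior N (fun i => decide (i = k)) = 1 := by
  simp [optBehavior, boolWeight_single]

theorem one_sub_optBehavior_false (N : ℕ) :
    1 - optBehavior N (fun _ => false) = 2 / (((N : ℝ) - 1) * (N - 2)) := by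
  simp [optBehavior, boolWeight_false]

theorem fingerF_optBehavior (N : ℕ) :
    fingerF N (optBehavior N) =
      (N : ℝ) / ((N : ℝ) + 1) +
        2 / (((N : ℝ) - 2) * ((N : ℝ) - 1) * ((N : ℝ) + 1)) := by
  simp only [fingerF, one_sub_optBehavior_false, optBehavior_single]
  simp only [Finset.sum_const, Finset.card_univ, Fintype.card_fin, nsmul_eq_mul, div_eq_mul_inv,
    mul_inv]
  ring

theorem fingerF_le {N : ℕ} (hN : 3 < N) {p : (Fin N → Bool) → ℝ} (hp : p ∈ InterfSet N 2) :
    fingerF N p ≤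
      (N : ℝ) / ((N : ℝ) + 1) +
        2 / (((N : ℝ) - 2) * ((N : ℝ) - 1) * ((N : ℝ) + 1)) := by
  obtain ⟨hI, hF⟩ := hp
  have hN' : (4 : ℝ) ≤ N := by exact_mod_cast hN
  have key := interpolation_of_bFourier_eq_zero p hF
  have hE : ∑ k, p (fun i => decide (i = k)) ≤ N :=
    (Finset.sum_le_sum fun k _ => (hI _).2).trans_eq (by simp)
  have hR : ∑ j, ∑ k, p (fun i => xor (decide (i = j)) (decide (i = k))) ≤
      N * (p (fun _ => false) + (N - 1)) := by
    have hrow (j : Fin N) : ∑ k, p (fun i => xor (decide (i = j)) (decide (i = k))) ≤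
        p (fun _ => false) + (N - 1) := by
      rw [← Finset.add_sum_erase _ _ (Finset.mem_univ j)]
      refine add_le_add (by simp) ((Finset.sum_le_sum fun k _ => (hI _).2).trans_eq ?_)
      simp [Nat.cast_sub (show 1 ≤ N by omega)]
    exact (Finset.sum_le_sum fun j _ => hrow j).trans_eq (by simp [mul_add])
  have h1 := (hI (fun _ => true)).1
  rw [fingerF]
  generalize ∑ k, p (fun i => decide (i = k)) = E at *
  generalize ∑ j, ∑ k, p (fun i => xor (decide (i = j)) (decide (i = k))) = R at *
  have hD : 0 < ((N : ℝ) - 2) * (N - 1) := mul_pos (by linarith) (by linarith)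
  have hmul : 0 ≤ ((N : ℝ) - 2) * (N - 3) * (N - E) :=
    mul_nonneg (mul_nonneg (by linarith) (by linarith)) (by linarith)
  have hle : 1 - p (fun _ => false) + E ≤ N + 2 / (((N : ℝ) - 2) * (N - 1)) := by
    rw [← sub_le_iff_le_add', le_div_iff₀ hD]
    linarith
  calc 1 / ((N : ℝ) + 1) * (1 - p (fun _ => false) + E)
      ≤ 1 / ((N : ℝ) + 1) * (N + 2 / (((N : ℝ) - 2) * (N - 1))) :=
        mul_le_mul_of_nonneg_left hle (by positivity)
    _ = _ := by
        simp only [div_eq_mul_inv, mul_inv]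
        ring

/-- Theorem 2: for every integer `N > 3`, the set of values of the
fingerprinting functional over second-order interference behaviors has greatest
element `N/(N+1) + 2/((N−2)(N−1)(N+1))`; moreover the maximum is attained by a behavior
`p` with `1 − p(0,…,0) = 2/(N²−3N+2)` and `p(e_k) = 1` for all `k`. -/
theorem stmt17 (N : ℕ) (hN : 3 < N) :
    IsGreatest (fingerF N '' InterfSet N 2)
        ((N : ℝ) / ((N : ℝ) + 1) +
          2 / (((N : ℝ) - 2) * ((N : ℝ) - 1) * ((N : ℝ) + 1))) ∧
      ∃ p ∈ InterfSet N 2,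
        fingerF N p =
            (N : ℝ) / ((N : ℝ) + 1) +
              2 / (((N : ℝ) - 2) * ((N : ℝ) - 1) * ((N : ℝ) + 1)) ∧
          (1 - p (fun _ => false)) = 2 / ((N : ℝ) ^ 2 - 3 * (N : ℝ) + 2) ∧
          ∀ k : Fin N, p (fun i => decide (i = k)) = 1 := by
  refine ⟨⟨⟨_, optBehavior_mem_interfSet hN, fingerF_optBehavior N⟩, ?_⟩,
    _, optBehavior_mem_interfSet hN, fingerF_optBehavior N, ?_, optBehavior_single⟩
  · rintro _ ⟨p, hp, rfl⟩
    exact fingerF_le hN hp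
  · rw [one_sub_optBehavior_false]
    ring
end

section
/- The optimal second-order interference behavior: for every integer N > 3, define p* : {0,1}^N → ℝ by p*(x) = (N − w(x))·(w(x) + N − 3) / ((N−2)(N−1)), where w(x) is the Hamming weight of x. Then (a) 0 ≤ p*(x) ≤ 1 for all x; (b) the Fourier coefficients p̂*(S) vanish for every subset S ⊆ {1,…,N} with |S| > 2, so p* ∈ J_{N,2}; and (c) F_N(p*) = N/(N+1) + 2/((N−2)(N−1)(N+1)). -/
/-- The Hamming weight `w(x)` of a bit string `x ∈ {0,1}^N`. -/
def hamWt {N : ℕ} (x : Fin N → Bool) : ℕ :=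
  (Finset.univ.filter fun i => x i = true).card

/-- The optimal second-order interference behavior
`p*(x) = (N − w(x))(w(x) + N − 3) / ((N−2)(N−1))`. -/
noncomputable def pStar (N : ℕ) (x : Fin N → Bool) : ℝ :=
  (((N : ℝ) - (hamWt x : ℝ)) * ((hamWt x : ℝ) + (N : ℝ) - 3)) /
    (((N : ℝ) - 2) * ((N : ℝ) - 1))

/-- Flipping a bit in `S` negates the character `χ_S`. -/
lemma character_update_not {N : ℕ} (S : Finset (Fin N)) {k : Fin N} (hk : k ∈ S)
    (x : Fin N → Bool) :
    (-1 : ℝ) ^ (S.filter (fun i => Function.update x k (!x k) i = true)).card =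
      -(-1 : ℝ) ^ (S.filter (fun i => x i = true)).card := by
  have prod_form : ∀ y : Fin N → Bool,
      (-1 : ℝ) ^ (S.filter (fun i => y i = true)).card =
        ∏ i ∈ S, if y i = true then (-1 : ℝ) else 1 := by
    intro y
    rw [Finset.prod_ite]
    simp
  rw [prod_form, prod_form, ← Finset.mul_prod_erase S _ hk, ← Finset.mul_prod_erase S _ hk]
  have h : ∏ i ∈ S.erase k, (if Function.update x k (!x k) i = true then (-1 : ℝ) else 1) =
      ∏ i ∈ S.erase k, (if x i = true then (-1 : ℝ) else 1) := by
    refine Finset.prod_congr rfl fun i hi => ?_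
    rw [Function.update_of_ne (Finset.ne_of_mem_erase hi)]
  rw [h]
  cases hx : x k <;> simp

/-- A function that does not depend on some bit in `S` is orthogonal to `χ_S`. -/
lemma sum_character_mul_eq_zero {N : ℕ} (S : Finset (Fin N)) {k : Fin N} (hk : k ∈ S)
    (g : (Fin N → Bool) → ℝ) (hg : ∀ x, g (Function.update x k (!x k)) = g x) :
    ∑ x : Fin N → Bool, (-1 : ℝ) ^ (S.filter (fun i => x i = true)).card * g x = 0 := by
  refine Finset.sum_involution (fun x _ => Function.update x k (!x k)) ?_ ?_ ?_ ?_
  · intro x _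
    rw [character_update_not S hk, hg]
    ring
  · intro x _ _ h
    have := congrFun h k
    simp at this
  · intro x _
    exact Finset.mem_univ _
  · intro x _
    simp

lemma hamWt_eq_sum {N : ℕ} (x : Fin N → Bool) :
    (hamWt x : ℝ) = ∑ i, if x i = true then (1 : ℝ) else 0 := by
  simp [hamWt]

lemma hamWt_le {N : ℕ} (x : Fin N → Bool) : hamWt x ≤ N := by
  simpa [hamWt] using Finset.card_filter_le (Finset.univ : Finset (Fin N)) (fun i => x i = true)

/-- `p*` as a combination of functions of at most two bits. -/
lemma pStar_eq_sum {N : ℕ} (hN : N ≠ 0) (x : Fin N → Bool) :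
    pStar N x = ∑ i, ∑ j, (1 - if x i = true then (1 : ℝ) else 0) *
      ((if x j = true then (1 : ℝ) else 0) + ((N : ℝ) - 3) / N) /
        (((N : ℝ) - 2) * ((N : ℝ) - 1)) := by
  have hN' : (N : ℝ) ≠ 0 := Nat.cast_ne_zero.mpr hN
  simp_rw [← Finset.sum_div, ← Finset.mul_sum, ← Finset.sum_mul]
  rw [Finset.sum_add_distrib, Finset.sum_sub_distrib, ← hamWt_eq_sum]
  simp only [Finset.sum_const, Finset.card_univ, Fintype.card_fin, nsmul_eq_mul, mul_one]
  rw [mul_div_cancel₀ _ hN', pStar, add_sub_assoc]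

lemma bFourier_pStar_eq_zero {N : ℕ} (S : Finset (Fin N)) (hS : 2 < S.card) :
    bFourier (pStar N) S = 0 := by
  have hN : N ≠ 0 := by
    rintro rfl
    simp [Finset.eq_empty_of_isEmpty S] at hS
  rw [bFourier, div_eq_zero_iff]
  left
  simp_rw [pStar_eq_sum hN, Finset.mul_sum]
  rw [Finset.sum_comm]
  refine Finset.sum_eq_zero fun i _ => ?_
  rw [Finset.sum_comm]
  refine Finset.sum_eq_zero fun j _ => ?_
  obtain ⟨k, hk, hkij⟩ : ∃ k ∈ S, k ∉ ({i, j} : Finset (Fin N)) :=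
    Finset.exists_mem_notMem_of_card_lt_card (Finset.card_le_two.trans_lt hS)
  simp only [Finset.mem_insert, Finset.mem_singleton, not_or] at hkij
  refine sum_character_mul_eq_zero S hk (fun x => (1 - if x i = true then (1 : ℝ) else 0) *
      ((if x j = true then (1 : ℝ) else 0) + ((N : ℝ) - 3) / N) /
        (((N : ℝ) - 2) * ((N : ℝ) - 1))) fun x => ?_
  simp only [Function.update_of_ne (Ne.symm hkij.1), Function.update_of_ne (Ne.symm hkij.2)]

lemma pStar_mem_Icc {N : ℕ} (hN : 3 < N) (x : Fin N → Bool) :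
    0 ≤ pStar N x ∧ pStar N x ≤ 1 := by
  have hN' : (3 : ℝ) < N := by exact_mod_cast hN
  have hw : (hamWt x : ℝ) ≤ N := by exact_mod_cast hamWt_le x
  have hw0 : (0 : ℝ) ≤ hamWt x := Nat.cast_nonneg _
  have hD : 0 < ((N : ℝ) - 2) * ((N : ℝ) - 1) := mul_pos (by linarith) (by linarith)
  have key : 0 ≤ ((hamWt x : ℝ) - 1) * ((hamWt x : ℝ) - 2) := by
    rcases Nat.lt_or_ge (hamWt x) 2 with h | h
    · have h' : (hamWt x : ℝ) ≤ 1 := by exact_mod_cast Nat.le_of_lt_succ h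
      exact mul_nonneg_of_nonpos_of_nonpos (by linarith) (by linarith)
    · have h' : (2 : ℝ) ≤ hamWt x := by exact_mod_cast h
      exact mul_nonneg (by linarith) (by linarith)
  refine ⟨div_nonneg (mul_nonneg (by linarith) (by linarith)) hD.le, ?_⟩
  rw [pStar, div_le_one hD]
  linarith

lemma fingerF_pStar {N : ℕ} (hN : 3 < N) :
    fingerF N (pStar N) =
      (N : ℝ) / ((N : ℝ) + 1) +
        2 / (((N : ℝ) - 2) * ((N : ℝ) - 1) * ((N : ℝ) + 1)) := by
  have hN' : (3 : ℝ) < N := by exact_mod_cast hN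
  have h1 : (N : ℝ) - 1 ≠ 0 := by linarith
  have h2 : (N : ℝ) - 2 ≠ 0 := by linarith
  have h3 : (N : ℝ) + 1 ≠ 0 := by linarith
  have hzero : hamWt (fun _ : Fin N => false) = 0 := by simp [hamWt]
  have hone : ∀ k : Fin N, pStar N (fun i => decide (i = k)) = 1 := by
    intro k
    have hk : hamWt (fun i : Fin N => decide (i = k)) = 1 := by
      simp [hamWt, Finset.filter_eq']
    rw [pStar, hk]
    field_simp
    push_cast
    ring
  simp only [fingerF, hone, Finset.sum_const, Finset.card_univ, Fintype.card_fin, nsmul_eq_mul]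
  rw [pStar, hzero]
  field_simp
  push_cast
  ring

/-- for every integer `N > 3`:
(a) `0 ≤ p*(x) ≤ 1` for all `x`;
(b) `p̂*(S) = 0` for every `S` with `|S| > 2` (so `p* ∈ J_{N,2}`);
(c) `F_N(p*) = N/(N+1) + 2/((N−2)(N−1)(N+1))`. -/
theorem stmt18 (N : ℕ) (hN : 3 < N) :
    (∀ x : Fin N → Bool, 0 ≤ pStar N x ∧ pStar N x ≤ 1) ∧
      (∀ S : Finset (Fin N), 2 < S.card → bFourier (pStar N) S = 0) ∧
      fingerF N (pStar N) =
        (N : ℝ) / ((N : ℝ) + 1) +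
          2 / (((N : ℝ) - 2) * ((N : ℝ) - 1) * ((N : ℝ) + 1)) := by
  exact ⟨pStar_mem_Icc hN, bFourier_pStar_eq_zero, fingerF_pStar hN⟩
end
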